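/- arXiv:1610.03587 — 3 statements merged into one kernel-verified Lean document; each statement's English description precedes it below -/
import Mathlib

section
/- Let p be an odd prime and let u₁ ≤ u₂ ≤ ⋯ ≤ u_s and m be positive integers. If p^{u₂} ≥ p^{3u₁+1}u₂, s ≥ 3, p^{u₂} ≥ 2^s, p^{u₁−1} > 5 and 2^{p^m} > p^{3u₁} − p^{2u₁}, then there exists a strictly optimal (p(2^{p^m}−1)·∏_{i=1}^s(p^{u_i}−1), p^{u₁−1}, p; 2^{p^m}(1 + Σ_{i=1}^s ∏_{j=i}^s p^{u_j}) − 1)-FHS set; that is, there exists a set S of M = p^{u₁−1} FHSs of length n = p(2^{p^m}−1)·∏_{i=1}^s(p^{u_i}−1) over an alphabet of size l = 2^{p^m}(1 + Σ_{i=1}^s ∏_{j=i}^s p^{u_j}) − 1 such that H(S;L) ≤ ⌈Lp/n⌉ for every L with 1 ≤ L ≤ n, where p = ⌈(2InM−(I+1)Il)/((nM−1)M)⌉ with I = ⌊nM/l⌋. -/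
/-- Partial Hamming correlation `H_{X,Y}(τ; j | L)` of the frequency hopping
sequences `X, Y : ZMod n → F` for shift `τ`, window start `j` and window length `L`. -/
def partialHC {n : ℕ} {F : Type*} [DecidableEq F] (X Y : ZMod n → F)
    (τ j : ZMod n) (L : ℕ) : ℕ :=
  ∑ t ∈ Finset.range L, if X (j + (t : ZMod n)) = Y (j + (t : ZMod n) + τ) then 1 else 0

/-- The Peng–Fan bound value `⌈(2InM − (I+1)Il) / ((nM−1)M)⌉` where `I = ⌊nM/l⌋`. -/
def pengFanBound (n M l : ℕ) : ℤ :=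
  ⌈(((2 * (n * M / l) * n * M : ℕ) : ℚ) - (((n * M / l + 1) * (n * M / l) * l : ℕ) : ℚ))
    / ((((n * M : ℕ) : ℚ) - 1) * (M : ℚ))⌉

/-- There is a strictly optimal `(n, M, λ; l)`-FHS set (with respect to the Peng–Fan
bound): `λ` equals the Peng–Fan bound value and there are `M` pairwise distinct FHSs of
length `n` over an alphabet of size `l` whose maximum nontrivial partial Hamming
correlation satisfies `H(S; L) ≤ ⌈Lλ/n⌉` for every window length `1 ≤ L ≤ n`. -/
def IsStrictlyOptimalFHSSet (n M lam l : ℕ) : Prop :=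
  (lam : ℤ) = pengFanBound n M l ∧
  ∃ X : Fin M → (ZMod n → Fin l),
    (∀ a b : Fin M, a ≠ b → X a ≠ X b) ∧
    ∀ L : ℕ, 1 ≤ L → L ≤ n →
      (∀ a : Fin M, ∀ τ : ZMod n, τ ≠ 0 → ∀ j : ZMod n,
        (partialHC (X a) (X a) τ j L : ℤ) ≤ ⌈((L * lam : ℕ) : ℚ) / (n : ℚ)⌉) ∧
      (∀ a b : Fin M, a ≠ b → ∀ τ j : ZMod n,
        (partialHC (X a) (X b) τ j L : ℤ) ≤ ⌈((L * lam : ℕ) : ℚ) / (n : ℚ)⌉)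

/-- A labelled partition of `ℤ / N`: `b` names the block of a residue and `x` is a label in the
additive group `V`, such that labels are distinct within a block and a nonzero shift together
with a difference of labels occurs at most once inside the blocks. The number of blocks is `c`. -/
def HasLabelledPartition (V : Type) [AddCommGroup V] (N c : ℕ) : Prop :=
  ∃ (B : Type) (_ : Fintype B) (x : ℤ → V) (b : ℤ → B), Fintype.card B = c ∧
    (∀ t k : ℤ, x (t + N * k) = x t ∧ b (t + N * k) = b t) ∧
    (∀ t t' : ℤ, x t = x t' → b t = b t' → (N : ℤ) ∣ t' - t) ∧
    (∀ σ t t' : ℤ, ¬ (N : ℤ) ∣ σ → b t = b (t + σ) → b t' = b (t' + σ) →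
      x t - x (t + σ) = x t' - x (t' + σ) → (N : ℤ) ∣ t' - t)

theorem exists_zpow_eq_one_iff (K : Type) [Field K] [Fintype K] :
    ∃ w : Kˣ, ∀ j : ℤ, w ^ j = 1 ↔ ((Fintype.card K - 1 : ℕ) : ℤ) ∣ j := by
  classical
  obtain ⟨w, hw⟩ := IsCyclic.exists_generator (α := Kˣ)
  refine ⟨w, fun j => ?_⟩
  rw [← orderOf_dvd_iff_zpow_eq_one, orderOf_eq_card_of_forall_mem_zpowers hw,
    Nat.card_eq_fintype_card, Fintype.card_units]

theorem hasLabelledPartition_field (K : Type) [Field K] [Fintype K] :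
    HasLabelledPartition K (Fintype.card K - 1) 1 := by
  obtain ⟨w, hw⟩ := exists_zpow_eq_one_iff K
  have key : ∀ t t' : ℤ, w ^ t = w ^ t' → ((Fintype.card K - 1 : ℕ) : ℤ) ∣ t' - t := by
    intro t t' h
    rw [← hw, zpow_sub, h, mul_inv_cancel]
  refine ⟨Unit, inferInstance, fun t => ((w ^ t : Kˣ) : K), fun _ => (), by simp, ?_, ?_, ?_⟩
  · intro t k
    refine ⟨?_, rfl⟩
    beta_reduce
    rw [zpow_add, (hw _).2 (dvd_mul_right _ _), mul_one]
  · intro t t' h _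
    exact key t t' (Units.ext h)
  · intro σ t t' hσ _ _ h
    apply key
    have h1 : ((w ^ σ : Kˣ) : K) ≠ 1 := fun h => hσ ((hw σ).1 (Units.ext h))
    simp only [zpow_add, Units.val_mul] at h
    apply Units.ext
    refine mul_right_cancel₀ (sub_ne_zero.2 h1.symm) ?_
    linear_combination h

theorem HasLabelledPartition.lift {V : Type} [AddCommGroup V] [Fintype V] {N c : ℕ} (hN : 0 < N)
    (h : HasLabelledPartition V N c) (K : Type) [Field K] [Fintype K]
    (hK : Fintype.card V ≤ Fintype.card K) :
    HasLabelledPartition V (N * (Fintype.card K - 1)) (c * Fintype.card K) := by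
  obtain ⟨B, _, x, b, hc, hper, hinj, hdiff⟩ := h
  obtain ⟨w, hw⟩ := exists_zpow_eq_one_iff K
  obtain ⟨φ⟩ := Function.Embedding.nonempty_of_card_le hK
  have hN' : (N : ℤ) ≠ 0 := by exact_mod_cast hN.ne'
  have hdiv : ∀ t k : ℤ, (t + N * k) / N = t / N + k := fun t k =>
    Int.add_mul_ediv_left t k hN'
  have hlift : ∀ j : ℤ, w ^ j = 1 → ((N * (Fintype.card K - 1) : ℕ) : ℤ) ∣ N * j := by
    intro j hj
    rw [Nat.cast_mul]
    exact mul_dvd_mul_left _ ((hw j).1 hj)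
  have hcancel : ∀ k j : ℤ, ((w ^ k : Kˣ) : K) = ((w ^ (k + j) : Kˣ) : K) → w ^ j = 1 := by
    intro k j h
    have := Units.ext h
    rw [zpow_add] at this
    exact left_eq_mul.1 this
  have hinj' : ∀ t t' : ℤ, x t = x t' → b t = b t' →
      ((w ^ (t / N) : Kˣ) : K) + φ (x t) = ((w ^ (t' / N) : Kˣ) : K) + φ (x t') →
      ((N * (Fintype.card K - 1) : ℕ) : ℤ) ∣ t' - t := by
    intro t t' hx hb hk
    obtain ⟨j, hj⟩ := hinj t t' hx hb
    obtain rfl : t' = t + N * j := by linarith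
    rw [hj]
    rw [hx, hdiv] at hk
    exact hlift j (hcancel _ _ (add_right_cancel hk))
  refine ⟨B × K, inferInstance, x, fun t => (b t, ((w ^ (t / N) : Kˣ) : K) + φ (x t)),
    by simp [hc], ?_, ?_, ?_⟩
  · intro t k
    have e : t + ((N * (Fintype.card K - 1) : ℕ) : ℤ) * k
        = t + N * (((Fintype.card K - 1 : ℕ) : ℤ) * k) := by push_cast; ring
    simp only [e, hdiv, (hper t _).1, (hper t _).2, true_and]
    rw [zpow_add, (hw _).2 (dvd_mul_right _ _), mul_one]
  · intro t t' hx hb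
    simp only [Prod.mk.injEq] at hb
    exact hinj' t t' hx hb.1 hb.2
  · intro σ t t' hσ hb hb' hx
    simp only [Prod.mk.injEq] at hb hb'
    by_cases hNσ : (N : ℤ) ∣ σ
    · obtain ⟨j, rfl⟩ := hNσ
      have := hinj' t (t + N * j) (hper t j).1.symm hb.1 hb.2
      simp only [add_sub_cancel_left] at this
      exact absurd this hσ
    · obtain ⟨j, hj⟩ := hdiff σ t t' hNσ hb.1 hb'.1 hx
      obtain rfl : t' = t + N * j := by linarith
      rw [hj]
      apply hlift
      have e : t + N * j + σ = (t + σ) + N * j := by ring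
      have hb2 := hb'.2
      rw [e, hdiv, hdiv, (hper t j).1, (hper (t + σ) j).1, zpow_add, zpow_add, Units.val_mul,
        Units.val_mul] at hb2
      have h0 : (((w ^ j : Kˣ) : K) - 1) *
          (((w ^ (t / N) : Kˣ) : K) - ((w ^ ((t + σ) / N) : Kˣ) : K)) = 0 := by
        linear_combination hb2 - hb.2
      rcases mul_eq_zero.1 h0 with h0 | h0
      · exact Units.ext (by simpa using sub_eq_zero.1 h0)
      · exfalso
        have hφ : φ (x t) = φ (x (t + σ)) := by linear_combination hb.2 - h0
        have := hinj t (t + σ) (φ.injective hφ) hb.1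
        rw [add_sub_cancel_left] at this
        exact hNσ this

theorem HasLabelledPartition.lift_prod {V : Type} [AddCommGroup V] [Fintype V] {N c : ℕ}
    (hN : 0 < N) (h : HasLabelledPartition V N c) {ι : Type} (S : Finset ι) (K : ι → Type)
    [∀ i, Field (K i)] [∀ i, Fintype (K i)]
    (hK : ∀ i, Fintype.card V ≤ Fintype.card (K i)) :
    HasLabelledPartition V (N * ∏ i ∈ S, (Fintype.card (K i) - 1))
      (c * ∏ i ∈ S, Fintype.card (K i)) := by
  classical
  induction S using Finset.induction_on with
  | empty => simpa using h
  | insert a S ha ih =>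
    have hpos : 0 < N * ∏ i ∈ S, (Fintype.card (K i) - 1) :=
      Nat.mul_pos hN (Finset.prod_pos fun i _ =>
        Nat.sub_pos_of_lt (Fintype.one_lt_card (α := K i)))
    have := ih.lift hpos (K a) (hK a)
    rw [Finset.prod_insert ha, Finset.prod_insert ha]
    convert this using 1 <;> ring

theorem card_le_of_pairwise_modEq {N : ℕ} (hN : 0 < N) (L : ℕ) (S : Finset ℕ)
    (hS : S ⊆ Finset.range L) (h : ∀ a ∈ S, ∀ b ∈ S, (N : ℤ) ∣ (b : ℤ) - a) :
    (S.card : ℤ) ≤ ⌈(L : ℚ) / N⌉ := by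
  have hNq : (0 : ℚ) < N := by exact_mod_cast hN
  have hle : S.card ≤ ⌈(L : ℚ) / N⌉₊ := by
    rw [← Finset.card_range ⌈(L : ℚ) / N⌉₊]
    refine Finset.card_le_card_of_injOn (fun k => k / N) ?_ ?_
    · intro k hk
      have hkL : k < L := Finset.mem_range.1 (hS hk)
      simp only [Finset.coe_range, Set.mem_Iio]
      rw [Nat.lt_ceil]
      calc ((k / N : ℕ) : ℚ) ≤ (k : ℚ) / N := Nat.cast_div_le
        _ < (L : ℚ) / N := by gcongr
    · intro a ha b hb hab
      have hmod : a % N = b % N := (Nat.modEq_iff_dvd.2 (h a ha b hb))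
      rw [← Nat.div_add_mod a N, ← Nat.div_add_mod b N, hmod]
      simp only at hab
      rw [hab]
  rw [← Int.natCast_ceil_eq_ceil (by positivity)]
  exact_mod_cast hle

theorem HasLabelledPartition.exists_sequences {V : Type} [Field V] [Fintype V]
    {p u N c l : ℕ} [CharP V p] (hV : Nat.card V = p ^ u) (hp : p.Prime) (hu : 0 < u)
    (hN : 0 < N) (hpN : p.Coprime N) (h : HasLabelledPartition V N c) (hl : p ^ u * c ≤ l) :
    ∃ X : Fin (p ^ (u - 1)) → (ZMod (p * N) → Fin l),
    (∀ a b, a ≠ b → X a ≠ X b) ∧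
    ∀ L : ℕ, 1 ≤ L → L ≤ p * N →
      (∀ a, ∀ τ : ZMod (p * N), τ ≠ 0 → ∀ j : ZMod (p * N),
        (partialHC (X a) (X a) τ j L : ℤ) ≤ ⌈((L * p : ℕ) : ℚ) / ((p * N : ℕ) : ℚ)⌉) ∧
      (∀ a b, a ≠ b → ∀ τ j : ZMod (p * N),
        (partialHC (X a) (X b) τ j L : ℤ) ≤ ⌈((L * p : ℕ) : ℚ) / ((p * N : ℕ) : ℚ)⌉) := by
  have : NeZero (p * N) := ⟨(Nat.mul_pos hp.pos hN).ne'⟩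
  obtain ⟨B, _, x, b, hc, hper, hinj, hdiff⟩ := h
  let H : AddSubgroup V := AddSubgroup.zmultiples (1 : V)
  have hH : Nat.card H = p := by
    rw [Nat.card_zmultiples]
    exact CharP.eq V (CharP.addOrderOf_one V) inferInstance
  have hQ : Nat.card (V ⧸ H) = p ^ (u - 1) := by
    have := AddSubgroup.card_eq_card_quotient_mul_card_addSubgroup H
    rw [hV, hH] at this
    obtain ⟨v, rfl⟩ : ∃ v, u = v + 1 := ⟨u - 1, by omega⟩
    rw [pow_succ] at this
    exact (Nat.eq_of_mul_eq_mul_right hp.pos this).symm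
  let e : Fin (p ^ (u - 1)) ≃ V ⧸ H := (Finite.equivFinOfCardEq hQ).symm
  let r : Fin (p ^ (u - 1)) → V := fun a => (e a).out
  have hr : ∀ a a' (k : ℤ), r a = r a' + k → a = a' := by
    intro a a' k hk
    apply e.injective
    rw [← QuotientAddGroup.out_eq' (e a), ← QuotientAddGroup.out_eq' (e a'), QuotientAddGroup.eq]
    refine AddSubgroup.mem_zmultiples_iff.2 ⟨-k, ?_⟩
    change _ = -r a + r a'
    rw [hk]
    simp
  let Y : Fin (p ^ (u - 1)) → ℤ → V × B := fun a t => (r a + t + x t, b t)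
  have hY : ∀ a (t k : ℤ), Y a (t + (p * N : ℕ) * k) = Y a t := by
    intro a t k
    have e1 : t + ((p * N : ℕ) : ℤ) * k = t + N * (p * k) := by push_cast; ring
    have e2 : (((p * N : ℕ) : ℤ) : V) = 0 := by simp
    simp only [Y]
    rw [Int.cast_add, Int.cast_mul, e2, e1, (hper t _).1, (hper t _).2, zero_mul, add_zero]
  have hcard : Fintype.card (V × B) ≤ Fintype.card (Fin l) := by
    rw [Fintype.card_prod, hc, Fintype.card_fin, ← Nat.card_eq_fintype_card, hV]
    exact hl
  obtain ⟨ψ⟩ := Function.Embedding.nonempty_of_card_le hcard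
  have hunique : ∀ a a' (τ t t' : ℤ), (a = a' → ¬ ((p * N : ℕ) : ℤ) ∣ τ) →
      Y a t = Y a' (t + τ) → Y a t' = Y a' (t' + τ) → ¬ (N : ℤ) ∣ τ ∧ (N : ℤ) ∣ t' - t := by
    intro a a' τ t t' hne h1 h2
    simp only [Y, Prod.mk.injEq, Int.cast_add] at h1 h2
    have hNτ : ¬ (N : ℤ) ∣ τ := by
      rintro ⟨k, hk⟩
      have hx := (hper t k).1
      rw [← hk] at hx
      have hra : r a = r a' + τ := by
        rw [hx] at h1
        linear_combination h1.1
      have haa := hr _ _ _ hra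
      refine hne haa ?_
      rw [haa, left_eq_add] at hra
      have hpτ : (p : ℤ) ∣ τ := (CharP.intCast_eq_zero_iff V p τ).1 hra
      rw [Nat.cast_mul]
      exact IsCoprime.mul_dvd (Nat.isCoprime_iff_coprime.2 hpN) hpτ ⟨k, hk⟩
    refine ⟨hNτ, hdiff τ t t' hNτ h1.2 h2.2 ?_⟩
    linear_combination h1.1 - h2.1
  let X : Fin (p ^ (u - 1)) → (ZMod (p * N) → Fin l) := fun a z => ψ (Y a (z.val : ℤ))
  have hX : ∀ a (t : ℤ), X a (t : ZMod (p * N)) = ψ (Y a t) := by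
    intro a t
    simp only [X]
    congr 1
    rw [ZMod.val_intCast]
    conv_rhs => rw [← Int.emod_add_mul_ediv t ((p * N : ℕ) : ℤ)]
    rw [hY]
  have hbound : ∀ a a' (τ j : ZMod (p * N)) (L : ℕ), (a = a' → τ ≠ 0) →
      (partialHC (X a) (X a') τ j L : ℤ) ≤ ⌈((L * p : ℕ) : ℚ) / ((p * N : ℕ) : ℚ)⌉ := by
    intro a a' τ j L hne
    obtain ⟨τ, rfl⟩ := ZMod.intCast_surjective τ
    obtain ⟨j, rfl⟩ := ZMod.intCast_surjective j
    have hratio : ((L * p : ℕ) : ℚ) / ((p * N : ℕ) : ℚ) = (L : ℚ) / N := by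
      have : (p : ℚ) ≠ 0 := by exact_mod_cast hp.ne_zero
      push_cast
      rw [mul_comm (L : ℚ), mul_div_mul_left _ _ this]
    rw [hratio, partialHC, Finset.sum_boole]
    refine card_le_of_pairwise_modEq hN L _ (Finset.filter_subset _ _) ?_
    intro k hk k' hk'
    have hcoin : ∀ k : ℕ, X a (j + (k : ZMod (p * N))) = X a' (j + (k : ZMod (p * N)) + τ) →
        Y a (j + k) = Y a' (j + k + τ) := by
      intro k hk
      have e1 : (j : ZMod (p * N)) + (k : ZMod (p * N)) = ((j + k : ℤ) : ZMod (p * N)) := by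
        push_cast; rfl
      have e2 : (j : ZMod (p * N)) + (k : ZMod (p * N)) + τ
          = ((j + k + τ : ℤ) : ZMod (p * N)) := by
        push_cast; rfl
      rw [e2, e1, hX, hX] at hk
      exact ψ.injective hk
    have hd := (hunique a a' τ _ _
      (fun h hd => hne h ((ZMod.intCast_zmod_eq_zero_iff_dvd _ _).2 hd))
      (hcoin k (Finset.mem_filter.1 hk).2) (hcoin k' (Finset.mem_filter.1 hk').2)).2
    simpa using hd
  refine ⟨X, ?_, fun L _ _ => ⟨fun a τ hτ j => hbound a a τ j L fun _ => hτ,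
    fun a a' ha τ j => hbound a a' τ j L fun h => absurd h ha⟩⟩
  intro a a' ha hXX
  have h0 : Y a 0 = Y a' (0 + 0) := by
    apply ψ.injective
    rw [← hX, add_zero, ← hX, hXX]
  exact (hunique a a' 0 0 0 (fun h => absurd h ha) h0 h0).1 (dvd_zero _)

theorem pengFanBound_eq {n M l p : ℕ} (hp : 1 < p) (hM : 0 < M) (hl : 0 < l)
    (hQ : 1 < n * M) (hup : n * M < p * M * l) (hlow : ((p - 1) * M + 1) * l ≤ n * M) :
    pengFanBound n M l = p := by
  have hIr := Nat.div_add_mod (n * M) l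
  have hr := Nat.mod_lt (n * M) hl
  have hI : n * M / l < p * M := (Nat.div_lt_iff_lt_mul hl).2 hup
  unfold pengFanBound
  rw [mul_assoc (2 * (n * M / l)) n M]
  generalize n * M = Q at *
  generalize Q / l = I at *
  generalize Q % l = r at *
  have hMq : (1 : ℚ) ≤ M := by exact_mod_cast hM
  have hlq : (1 : ℚ) ≤ l := by exact_mod_cast hl
  have hQq : (1 : ℚ) < Q := by exact_mod_cast hQ
  have hIq : (I : ℚ) ≤ p * M := by exact_mod_cast hI.le
  have hrq : (r : ℚ) + 1 ≤ l := by exact_mod_cast hr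
  have hr0 : (0 : ℚ) ≤ r := by positivity
  have hI0 : (0 : ℚ) ≤ I := by positivity
  have hIrq : (l : ℚ) * I + r = Q := by exact_mod_cast hIr
  have hlowq : (((p : ℚ) - 1) * M + 1) * l ≤ Q := by
    have : (((p - 1 : ℕ) : ℚ) * M + 1) * l ≤ Q := by exact_mod_cast hlow
    rwa [Nat.cast_pred (zero_lt_one.trans hp)] at this
  have hp1 : (1 : ℚ) < p := by exact_mod_cast hp
  have hden : (0 : ℚ) < ((Q : ℚ) - 1) * M := mul_pos (by linarith) (by linarith)
  rw [Int.ceil_eq_iff]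
  push_cast
  constructor
  · rw [lt_div_iff₀ hden]
    have h1 : ((Q : ℚ) - l) * Q ≤ l * (2 * I * Q - (I + 1) * I * l) := by
      rw [← hIrq]
      nlinarith
    have h2 : ((p : ℚ) - 1) * M * l * Q ≤ ((Q : ℚ) - l) * Q := by
      apply mul_le_mul_of_nonneg_right _ (by linarith)
      linarith
    have h3 : ((p : ℚ) - 1) * M * Q ≤ 2 * I * Q - (I + 1) * I * l := by
      refine le_of_mul_le_mul_left ?_ (show (0 : ℚ) < l by linarith)
      linarith
    have h4 : 0 < ((p : ℚ) - 1) * M := mul_pos (by linarith) (by linarith)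
    nlinarith
  · rw [div_le_iff₀ hden]
    have h1 : 2 * (I : ℚ) * Q - (I + 1) * I * l ≤ I * (Q - 1) := by
      have : (I : ℚ) * (r + 1) ≤ I * l := mul_le_mul_of_nonneg_left hrq hI0
      rw [← hIrq]
      nlinarith
    nlinarith

theorem mul_prod_sub_one_ge {ι : Type} (S : Finset ι) (a : ι → ℕ) (D : ℕ) (hD : 0 < D)
    (ha : ∀ i, D ≤ a i) :
    D * ∏ i ∈ S, a i ≤ D * ∏ i ∈ S, (a i - 1) + S.card * ∏ i ∈ S, a i := by
  classical
  induction S using Finset.induction_on with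
  | empty => simp
  | insert i S hi ih =>
    rw [Finset.prod_insert hi, Finset.prod_insert hi, Finset.card_insert_of_notMem hi]
    obtain ⟨k, hk⟩ : ∃ k, a i = k + 1 := ⟨a i - 1, by have := ha i; omega⟩
    have hDk := ha i
    rw [hk] at hDk ⊢
    rw [Nat.add_sub_cancel]
    generalize ∏ i ∈ S, a i = P at *
    have h1 := Nat.mul_le_mul_left k ih
    have h2 := Nat.mul_le_mul_right P hDk
    nlinarith

theorem one_add_sum_prod_le {r : ℕ} (a : Fin (r + 1) → ℕ) (ha : ∀ i, 0 < a i)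
    (h0 : r + 1 ≤ a 0) :
    1 + ∑ i, ∏ j, (if i ≤ j then a j else 1) ≤ 2 * ∏ j, a j := by
  rw [Fin.sum_univ_succ]
  simp only [Fin.prod_univ_succ, Fin.zero_le, if_true, Fin.succ_le_succ_iff,
    Fin.le_zero_iff, Fin.succ_ne_zero, if_false, one_mul]
  set R := ∏ j : Fin r, a j.succ with hR
  have hR1 : 0 < R := Finset.prod_pos fun j _ => ha _
  have hle : ∑ i : Fin r, ∏ j : Fin r, (if i ≤ j then a j.succ else 1) ≤ r * R := by
    have : ∀ i ∈ (Finset.univ : Finset (Fin r)),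
        ∏ j : Fin r, (if i ≤ j then a j.succ else 1) ≤ R := by
      intro i _
      refine Finset.prod_le_prod' fun j _ => ?_
      have := ha j.succ
      split_ifs <;> omega
    simpa using Finset.sum_le_card_nsmul _ _ _ this
  nlinarith

theorem alphabet_mul_le {q₁ q P P' T : ℕ} (h5 : 5 ≤ q₁) (hq : q₁ ≤ q) (hT : 1 + T ≤ 2 * P)
    (hP : q₁ * P ≤ q₁ * P' + P) :
    (q₁ - 5) * (q * (1 + (q₁ * P + T)) - 1) ≤ q₁ * ((q - 1) * ((q₁ - 1) * P')) := by
  refine (Nat.mul_le_mul_left _ (Nat.sub_le _ 1)).trans ?_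
  obtain ⟨k, rfl⟩ : ∃ k, q₁ = k + 5 := ⟨q₁ - 5, by omega⟩
  obtain ⟨m, rfl⟩ : ∃ m, q = m + 1 := ⟨q - 1, by omega⟩
  have e1 : k + 5 - 1 = k + 4 := rfl
  rw [Nat.add_sub_cancel, Nat.add_sub_cancel, e1]
  have a1 : k * ((m + 1) * (1 + ((k + 5) * P + T))) ≤ k * ((m + 1) * ((k + 7) * P)) := by
    gcongr
    linarith
  refine a1.trans ?_
  refine Nat.le_of_mul_le_mul_left ?_ (show 0 < k + 5 by omega)
  have a2 : (k + 4) * P ≤ (k + 5) * P' := by linarith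
  have a3 : (k + 4) * (m + 1) ≤ (k + 5) * m := by linarith
  calc (k + 5) * (k * ((m + 1) * ((k + 7) * P)))
      = ((k + 5) * k * (k + 7)) * ((m + 1) * P) := by ring
    _ ≤ ((k + 4) * (k + 4) * (k + 4)) * ((m + 1) * P) := by
        apply Nat.mul_le_mul_right
        nlinarith
    _ = ((k + 4) * (m + 1)) * ((k + 4) * P) * (k + 4) := by ring
    _ ≤ ((k + 5) * m) * ((k + 5) * P') * (k + 4) := by gcongr
    _ = (k + 5) * ((k + 5) * (m * ((k + 4) * P'))) := by ring

theorem coprime_two_pow_sub_one {p : ℕ} (hp : p.Prime) (m : ℕ) :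
    p.Coprime (2 ^ p ^ m - 1) := by
  have : Fact p.Prime := ⟨hp⟩
  rw [hp.coprime_iff_not_dvd, ← CharP.cast_eq_zero_iff (ZMod p) p, Nat.cast_sub Nat.one_le_two_pow]
  push_cast
  rw [ZMod.pow_card_pow]
  norm_num

theorem coprime_pow_sub_one {p k : ℕ} (hp : p.Prime) (hk : 0 < k) : p.Coprime (p ^ k - 1) := by
  rw [hp.coprime_iff_not_dvd]
  intro h
  have h1 : p ∣ p ^ k := dvd_pow_self p hk.ne'
  have h2 := Nat.dvd_sub h1 h
  rw [Nat.sub_sub_self (Nat.one_le_pow _ _ hp.pos)] at h2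
  exact hp.one_lt.ne' (Nat.dvd_one.1 h2)

theorem hasLabelledPartition_galoisField {p m r : ℕ} [Fact p.Prime] (hm : m ≠ 0)
    (u : Fin (r + 1) → ℕ) (hu : ∀ i, u i ≠ 0) (hmono : Monotone u) (hq : p ^ u 0 ≤ 2 ^ m) :
    HasLabelledPartition (GaloisField p (u 0)) ((2 ^ m - 1) * ∏ i, (p ^ u i - 1))
      (2 ^ m * ∏ i : Fin r, p ^ u i.succ) := by
  have hp : p.Prime := Fact.out
  let (k : ℕ) : Fintype (GaloisField p k) := Fintype.ofFinite _
  let : Fintype (GaloisField 2 m) := Fintype.ofFinite _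
  have hcard : ∀ i, Fintype.card (GaloisField p (u i)) = p ^ u i := fun i => by
    rw [← Nat.card_eq_fintype_card, GaloisField.card p _ (hu i)]
  have hcard2 : Fintype.card (GaloisField 2 m) = 2 ^ m := by
    rw [← Nat.card_eq_fintype_card, GaloisField.card 2 _ hm]
  have hpos : ∀ i, 0 < p ^ u i - 1 := fun i =>
    Nat.sub_pos_of_lt (Nat.one_lt_pow (hu i) hp.one_lt)
  have hpos2 : 0 < 2 ^ m - 1 := Nat.sub_pos_of_lt (Nat.one_lt_two_pow hm)
  have h1 := (hasLabelledPartition_field (GaloisField p (u 0))).lift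
    (by rw [hcard]; exact hpos 0) (GaloisField 2 m) (by rw [hcard, hcard2]; exact hq)
  rw [hcard, hcard2] at h1
  have h2 := h1.lift_prod (Nat.mul_pos (hpos 0) hpos2) Finset.univ
    (fun i : Fin r => GaloisField p (u i.succ))
    (fun i => by
      rw [hcard, hcard]
      exact Nat.pow_le_pow_right hp.pos (hmono (Fin.zero_le _)))
  simp only [hcard] at h2
  rw [Fin.prod_univ_succ]
  convert h2 using 1 <;> ring

theorem stmt15 (p s m : ℕ) (hp : p.Prime) (hodd : Odd p) (hm : 0 < m) (hs : 3 ≤ s)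
    (u : Fin s → ℕ) (hu : ∀ i, 0 < u i) (hmono : Monotone u)
    (h1 : p ^ (3 * u ⟨0, by omega⟩ + 1) * u ⟨1, by omega⟩ ≤ p ^ u ⟨1, by omega⟩)
    (h2 : 2 ^ s ≤ p ^ u ⟨1, by omega⟩)
    (h3 : 5 < p ^ (u ⟨0, by omega⟩ - 1))
    (h4 : p ^ (3 * u ⟨0, by omega⟩) - p ^ (2 * u ⟨0, by omega⟩) < 2 ^ (p ^ m)) :
    IsStrictlyOptimalFHSSet
      (p * (2 ^ (p ^ m) - 1) * ∏ i : Fin s, (p ^ u i - 1))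
      (p ^ (u ⟨0, by omega⟩ - 1)) p
      (2 ^ (p ^ m) * (1 + ∑ i : Fin s, ∏ j : Fin s, if i ≤ j then p ^ u j else 1) - 1) := by
  obtain ⟨r, rfl⟩ : ∃ r, s = r + 2 := ⟨s - 2, by omega⟩
  have z0 : (⟨0, by omega⟩ : Fin (r + 2)) = 0 := rfl
  have z1 : (⟨1, by omega⟩ : Fin (r + 2)) = (0 : Fin (r + 1)).succ := rfl
  rw [z0] at h1 h3 h4 ⊢
  rw [z1] at h1 h2
  have hqpos : ∀ i, 0 < p ^ u i := fun i => Nat.pow_pos hp.pos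
  have hqq : p * p ^ (u 0 - 1) = p ^ u 0 := by
    rw [← pow_succ', Nat.sub_add_cancel (hu 0)]
  have hq₁ : 5 < p ^ u 0 := h3.trans_le (Nat.pow_le_pow_right hp.pos (Nat.sub_le _ _))
  have hq : p ^ u 0 ≤ 2 ^ p ^ m := by
    refine le_trans ?_ h4.le
    rw [mul_comm 3, mul_comm 2, pow_mul, pow_mul]
    apply Nat.le_sub_of_add_le
    nlinarith [Nat.mul_le_mul_left (p ^ u 0 ^ 2) hq₁.le]
  have hq₂ : p ^ u 0 * (r + 2) ≤ p ^ u (Fin.succ 0) := by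
    have hs' : 2 ^ (r + 2) ≤ 2 ^ (p * u (Fin.succ 0)) := by
      refine h2.trans ?_
      rw [pow_mul]
      exact Nat.pow_le_pow_left Nat.lt_two_pow_self.le _
    have hs'' := (Nat.pow_le_pow_iff_right (by norm_num)).1 hs'
    refine le_trans ?_ h1
    rw [pow_succ, mul_assoc]
    exact Nat.mul_le_mul (Nat.pow_le_pow_right hp.pos (by omega)) hs''
  have hq₂' : ∀ i : Fin (r + 1), p ^ u (Fin.succ 0) ≤ p ^ u i.succ := fun i =>
    Nat.pow_le_pow_right hp.pos (hmono (Fin.succ_le_succ_iff.2 (Fin.zero_le i)))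
  have hN : 0 < (2 ^ p ^ m - 1) * ∏ i, (p ^ u i - 1) :=
    Nat.mul_pos (Nat.sub_pos_of_lt (Nat.one_lt_two_pow (Nat.pow_pos hp.pos).ne'))
      (Finset.prod_pos fun i _ => Nat.sub_pos_of_lt (Nat.one_lt_pow (hu i).ne' hp.one_lt))
  have hcop : p.Coprime ((2 ^ p ^ m - 1) * ∏ i, (p ^ u i - 1)) :=
    Nat.Coprime.mul_right (coprime_two_pow_sub_one hp m)
      (Nat.Coprime.prod_right fun i _ => coprime_pow_sub_one hp (hu i))
  have hsum : ∑ i : Fin (r + 2), ∏ j : Fin (r + 2), (if i ≤ j then p ^ u j else 1)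
      = p ^ u 0 * ∏ i : Fin (r + 1), p ^ u i.succ
        + ∑ i : Fin (r + 1), ∏ j : Fin (r + 1), (if i ≤ j then p ^ u j.succ else 1) := by
    rw [Fin.sum_univ_succ]
    simp only [Fin.prod_univ_succ (n := r + 1), Fin.zero_le, if_true, Fin.succ_le_succ_iff,
      Fin.le_zero_iff, Fin.succ_ne_zero, if_false, one_mul]
  have hT := one_add_sum_prod_le (fun i : Fin (r + 1) => p ^ u i.succ) (fun i => hqpos _)
    (by nlinarith)
  have hP : p ^ u 0 * ∏ i : Fin (r + 1), p ^ u i.succ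
      ≤ p ^ u 0 * ∏ i : Fin (r + 1), (p ^ u i.succ - 1) + ∏ i : Fin (r + 1), p ^ u i.succ := by
    have hD := mul_prod_sub_one_ge Finset.univ (fun i : Fin (r + 1) => p ^ u i.succ)
      (p ^ u 0 * (r + 1)) (Nat.mul_pos (hqpos 0) r.succ_pos)
      (fun i => le_trans (by nlinarith) (hq₂' i))
    rw [Finset.card_univ, Fintype.card_fin] at hD
    refine Nat.le_of_mul_le_mul_left ?_ r.succ_pos
    rw [Nat.succ_eq_add_one]
    linarith
  rw [mul_assoc, hsum]
  have hlow := alphabet_mul_le hq₁.le hq hT hP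
  have hPpos : 0 < ∏ i : Fin (r + 1), p ^ u i.succ := Finset.prod_pos fun i _ => hqpos _
  have hP'le : ∏ i : Fin (r + 1), (p ^ u i.succ - 1) ≤ ∏ i : Fin (r + 1), p ^ u i.succ :=
    Finset.prod_le_prod' fun i _ => Nat.sub_le _ _
  have hprod : ∏ i, (p ^ u i - 1) = (p ^ u 0 - 1) * ∏ i : Fin (r + 1), (p ^ u i.succ - 1) :=
    Fin.prod_univ_succ _
  have hnM : p * ((2 ^ p ^ m - 1) * ∏ i, (p ^ u i - 1)) * p ^ (u 0 - 1)
      = p ^ u 0 * ((2 ^ p ^ m - 1) * ∏ i, (p ^ u i - 1)) := by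
    rw [← hqq]; ring
  generalize ∑ i : Fin (r + 1), ∏ j : Fin (r + 1), (if i ≤ j then p ^ u j.succ else 1) = T at *
  have hl : 2 ^ p ^ m * (p ^ u 0 * ∏ i : Fin (r + 1), p ^ u i.succ)
      ≤ 2 ^ p ^ m * (1 + (p ^ u 0 * ∏ i : Fin (r + 1), p ^ u i.succ + T)) - 1 := by
    apply Nat.le_sub_of_add_le
    have : 1 ≤ 2 ^ p ^ m := Nat.one_le_two_pow
    nlinarith [Nat.zero_le (2 ^ p ^ m * T)]
  have hNlt : (2 ^ p ^ m - 1) * ∏ i, (p ^ u i - 1)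
      < 2 ^ p ^ m * (p ^ u 0 * ∏ i : Fin (r + 1), p ^ u i.succ) := by
    rw [hprod]
    refine Nat.mul_lt_mul_of_lt_of_le (Nat.sub_lt (Nat.two_pow_pos _) one_pos)
      (Nat.mul_le_mul (Nat.sub_le _ _) hP'le) (Nat.mul_pos (hqpos 0) hPpos)
  have : Fact p.Prime := ⟨hp⟩
  let : Fintype (GaloisField p (u 0)) := Fintype.ofFinite _
  refine ⟨(pengFanBound_eq hp.one_lt (Nat.pow_pos hp.pos) ?_ ?_ ?_ ?_).symm,
    HasLabelledPartition.exists_sequences (GaloisField.card p _ (hu 0).ne') hp (hu 0) hN hcop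
      (hasLabelledPartition_galoisField (Nat.pow_pos hp.pos).ne' u (fun i => (hu i).ne') hmono hq)
      ?_⟩
  · exact (Nat.zero_le _).trans_lt (hNlt.trans_le hl)
  · rw [hnM]
    nlinarith
  · rw [hnM, hqq]
    exact Nat.mul_lt_mul_of_pos_left (hNlt.trans_le hl) (hqpos 0)
  · rw [hnM, hprod]
    refine le_trans (Nat.mul_le_mul_right _ ?_) hlow
    rw [Nat.sub_one_mul, hqq]
    omega
  · refine le_trans (le_of_eq ?_) hl
    ring
end

section
/- Let v be an odd integer with prime factorization v = p₁^{m₁}p₂^{m₂}⋯p_s^{m_s}, where p₁ < p₂ < ⋯ < p_s are primes, and let p be a prime such that p | p_i−1 for every 1 ≤ i ≤ s. Set f = (p₁−1)/p and let m be an integer with p^m > p₁−1. If p^m − 2(1+p) > 0 and f ≥ 2, then there exists a strictly optimal (pv(p^m−1), f, p; vp^m)-FHS set; that is, there exists a set S of M = f FHSs of length n = pv(p^m−1) over an alphabet of size l = vp^m such that H(S;L) ≤ ⌈Lp/n⌉ for every L with 1 ≤ L ≤ n, where p = ⌈(2InM−(I+1)Il)/((nM−1)M)⌉ with I = ⌊nM/l⌋.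 -/
/-- A `p`-th root of unity `a` and elements `c k` such that all the differences
`c k - c k' * a ^ i`, except the trivially vanishing ones, are units. -/
structure IsCosetSystem {R : Type*} [CommRing R] (p f : ℕ) (a : R) (c : Fin f → R) : Prop where
  pow_eq_one : a ^ p = 1
  isUnit_sub : ∀ (k k' : Fin f) (i : ℕ), k ≠ k' ∨ ¬ p ∣ i → IsUnit (c k - c k' * a ^ i)

theorem IsCosetSystem.prod {R S : Type*} [CommRing R] [CommRing S] {p f : ℕ} {a : R}
    {c : Fin f → R} {b : S} {d : Fin f → S} (h : IsCosetSystem p f a c)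
    (h' : IsCosetSystem p f b d) :
    IsCosetSystem p f (a, b) (fun k => (c k, d k)) where
  pow_eq_one := Prod.ext h.pow_eq_one h'.pow_eq_one
  isUnit_sub k k' i hi := Prod.isUnit_iff.2 ⟨h.isUnit_sub k k' i hi, h'.isUnit_sub k k' i hi⟩

theorem IsCosetSystem.map {R S : Type*} [CommRing R] [CommRing S] {p f : ℕ} {a : R}
    {c : Fin f → R} (h : IsCosetSystem p f a c) (φ : R →+* S) :
    IsCosetSystem p f (φ a) (fun k => φ (c k)) where
  pow_eq_one := by rw [← map_pow, h.pow_eq_one, map_one]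
  isUnit_sub k k' i hi := by simpa using (h.isUnit_sub k k' i hi).map φ

theorem exists_isCosetSystem_prime_pow {p f P e : ℕ} (hp : 0 < p) (hP : P.Prime) (he : 0 < e)
    (hdvd : p ∣ P - 1) (hf : p * f ≤ P - 1) :
    ∃ (a : ZMod (P ^ e)) (c : Fin f → ZMod (P ^ e)), IsCosetSystem p f a c := by
  have : Fact P.Prime := ⟨hP⟩
  obtain ⟨g, hg⟩ := IsCyclic.exists_generator (α := (ZMod P)ˣ)
  have hord : orderOf g = P - 1 := by
    rw [orderOf_eq_card_of_forall_mem_zpowers hg, Nat.card_eq_fintype_card, ZMod.card_units]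
  obtain ⟨d, hd⟩ := hdvd
  have hP1 : 0 < P - 1 := Nat.sub_pos_of_lt hP.one_lt
  have hfd : f ≤ d := Nat.le_of_mul_le_mul_left (hd ▸ hf) hp
  let γ : ZMod (P ^ e) := ((g : ZMod P).val : ℕ)
  let φ : ZMod (P ^ e) →+* ZMod P := ZMod.castHom (dvd_pow_self P he.ne') (ZMod P)
  have hφγ : φ γ = g := by simp [γ, φ]
  have hunit : ∀ x : ZMod (P ^ e), φ x ≠ 0 → IsUnit x := by
    intro x hx
    have : NeZero (P ^ e) := ⟨(pow_pos hP.pos e).ne'⟩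
    obtain ⟨y, rfl⟩ := ZMod.natCast_zmod_surjective x
    rw [ZMod.isUnit_iff_coprime]
    refine Nat.Coprime.pow_right _ ((Nat.Prime.coprime_iff_not_dvd hP).2 ?_).symm
    rwa [map_natCast, Ne, ZMod.natCast_eq_zero_iff] at hx
  have hγ : IsUnit γ := hunit γ (by rw [hφγ]; exact g.ne_zero)
  refine ⟨γ ^ (d * P ^ (e - 1)), fun k => γ ^ (k : ℕ), ?_, fun k k' i hi => hunit _ ?_⟩
  · obtain ⟨u, hu⟩ := hγ
    have := ZMod.pow_totient u
    rw [Nat.totient_prime_pow hP he, hd] at this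
    rw [← hu, ← pow_mul, ← Units.val_pow_eq_pow_val,
      show d * P ^ (e - 1) * p = P ^ (e - 1) * (p * d) by ring, this, Units.val_one]
  · have hfrob : φ (γ ^ (d * P ^ (e - 1))) = ((g ^ d : (ZMod P)ˣ) : ZMod P) := by
      rw [map_pow, hφγ, pow_mul, ZMod.pow_card_pow, Units.val_pow_eq_pow_val]
    rw [map_sub, map_mul, map_pow φ _ i, hfrob, map_pow, map_pow, hφγ, sub_ne_zero]
    intro h
    have h' : g ^ (k : ℕ) = g ^ ((k' : ℕ) + d * i) := by
      apply Units.ext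
      push_cast
      rw [h, pow_add, pow_mul, Units.val_pow_eq_pow_val]
    rw [pow_eq_pow_iff_modEq, hord, hd] at h'
    have hkk : (k : ℕ) = k' := by
      have := h'.of_mul_left p
      rw [Nat.ModEq, Nat.add_mul_mod_self_left, Nat.mod_eq_of_lt (k.2.trans_le hfd),
        Nat.mod_eq_of_lt (k'.2.trans_le hfd)] at this
      exact this
    rcases hi with hi | hi
    · exact hi (Fin.ext hkk)
    · apply hi
      rw [hkk] at h'
      have h0 : p * d ∣ d * i := by
        have : (k' : ℕ) + 0 ≡ k' + d * i [MOD p * d] := h'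
        exact (Nat.modEq_zero_iff_dvd).1 (Nat.ModEq.add_left_cancel' _ this).symm
      have hd0 : 0 < d := Nat.pos_of_mul_pos_left (hd ▸ hP1)
      rw [mul_comm p d] at h0
      exact Nat.dvd_of_mul_dvd_mul_left hd0 h0

theorem exists_isCosetSystem {p f : ℕ} (hp : 0 < p) (v : ℕ) (hv : v ≠ 0)
    (h : ∀ P : ℕ, P.Prime → P ∣ v → p ∣ P - 1 ∧ p * f ≤ P - 1) :
    ∃ (a : ZMod v) (c : Fin f → ZMod v), IsCosetSystem p f a c := by
  induction v using Nat.recOnPosPrimePosCoprime with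
  | zero => exact absurd rfl hv
  | one => exact ⟨1, 1, one_pow p, fun _ _ _ _ => isUnit_of_subsingleton _⟩
  | prime_pow P e hP he =>
    obtain ⟨h1, h2⟩ := h P hP (dvd_pow_self P he.ne')
    exact exists_isCosetSystem_prime_pow hp hP he h1 h2
  | coprime x y hx hy hxy ihx ihy =>
    obtain ⟨a, c, hac⟩ := ihx (by lia) fun P hP hd => h P hP (hd.mul_right y)
    obtain ⟨b, d, hbd⟩ := ihy (by lia) fun P hP hd => h P hP (hd.mul_left x)
    exact ⟨_, _, (hac.prod hbd).map (ZMod.chineseRemainder hxy).symm.toRingHom⟩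

/-- Representatives of distinct cosets of the prime field. -/
theorem exists_natCast_add_sub_ne_zero {K : Type*} [Field K] [Finite K] {p f : ℕ} [CharP K p]
    (hf : p * f ≤ Nat.card K) (hp : 0 < p) :
    ∃ e : Fin f → K, ∀ k k', k ≠ k' → ∀ w : ℕ, (w : K) + e k' - e k ≠ 0 := by
  let H : AddSubgroup K := AddSubgroup.zmultiples 1
  have hH : Nat.card H = p := by
    rw [Nat.card_zmultiples]
    exact CharP.eq K (CharP.addOrderOf_one K) ‹_›
  have hcard : f ≤ Nat.card (K ⧸ H) := by
    have := AddSubgroup.card_eq_card_quotient_mul_card_addSubgroup H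
    rw [this, hH, mul_comm] at hf
    exact Nat.le_of_mul_le_mul_right hf hp
  let E : Fin f → K ⧸ H := fun k => (Finite.equivFin (K ⧸ H)).symm (Fin.castLE hcard k)
  refine ⟨fun k => (E k).out, fun k k' hk w hw => hk ?_⟩
  have hE : E k = E k' := by
    rw [← QuotientAddGroup.out_eq' (E k), ← QuotientAddGroup.out_eq' (E k'),
      QuotientAddGroup.eq]
    refine AddSubgroup.mem_zmultiples_iff.2 ⟨-w, ?_⟩
    rw [zsmul_eq_mul, mul_one, Int.cast_neg, Int.cast_natCast]
    linear_combination -hw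
  exact Fin.castLE_injective hcard ((Finite.equivFin (K ⧸ H)).symm.injective hE)

/-- The `k`-th sequence of the construction, indexed by natural numbers. -/
def hopSeq {v f : ℕ} {K : Type*} [Field K] (a : ZMod v) (c : Fin f → ZMod v) (α : K)
    (e : Fin f → K) (k : Fin f) (t : ℕ) : ZMod v × K :=
  (c k * a ^ t * t, α ^ (t / v) + t + e k)

section hopSeq

variable {v f p q : ℕ} {K : Type*} [Field K] [CharP K p] {a : ZMod v} {c : Fin f → ZMod v}
  {α : K} {e : Fin f → K}

theorem hopSeq_periodic (hv : 0 < v) (ha : a ^ p = 1) (hα : α ^ q = 1) (k : Fin f) :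
    Function.Periodic (hopSeq a c α e k) (p * v * q) := by
  intro t
  have hdiv : (t + p * v * q) / v = t / v + q * p := by
    rw [show p * v * q = v * (q * p) by ring, Nat.add_mul_div_left _ _ hv]
  have hpow : a ^ (p * v * q) = 1 := by rw [mul_assoc, pow_mul, ha, one_pow]
  simp only [hopSeq, hdiv, pow_add, pow_mul α, hα, hpow]
  simp

/-- The coincidences of two shifted sequences lie in one residue class modulo `v * q`. -/
theorem hopSeq_coincidence_modEq (hp : p.Prime) (hv : 0 < v) (hpv : p.Coprime (v * q))
    (hc : IsCosetSystem p f a c) (hα : α ≠ 0) (hord : orderOf α = q)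
    (he : ∀ k k', k ≠ k' → ∀ w : ℕ, (w : K) + e k' - e k ≠ 0) {k k' : Fin f} {w : ℕ}
    (hw : k ≠ k' ∨ ¬ p * v * q ∣ w) {t u : ℕ}
    (ht : hopSeq a c α e k t = hopSeq a c α e k' (t + w))
    (hu : hopSeq a c α e k u = hopSeq a c α e k' (u + w)) : t ≡ u [MOD v * q] := by
  have haU : IsUnit a := IsUnit.of_pow_eq_one hc.pow_eq_one hp.ne_zero
  have key : ∀ t : ℕ, hopSeq a c α e k t = hopSeq a c α e k' (t + w) →
      c k * (t : ZMod v) = c k' * a ^ w * (t + w) := by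
    intro t ht
    have h1 := congrArg Prod.fst ht
    simp only [hopSeq, Nat.cast_add] at h1
    refine (haU.pow t).mul_left_cancel ?_
    rw [pow_add] at h1
    linear_combination h1
  have key2 : ∀ t : ℕ, hopSeq a c α e k t = hopSeq a c α e k' (t + w) →
      α ^ (t / v) * (1 - α ^ ((t % v + w) / v)) = w + e k' - e k := by
    intro t ht
    have h2 := congrArg Prod.snd ht
    have hdiv : (t + w) / v = t / v + (t % v + w) / v := by
      conv_lhs => rw [← Nat.mod_add_div t v]
      rw [add_right_comm, Nat.add_mul_div_left _ _ hv, add_comm]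
    simp only [hopSeq, hdiv, pow_add, Nat.cast_add] at h2
    linear_combination h2
  have hαpow : ∀ {i j : ℕ}, α ^ i = α ^ j → i ≡ j [MOD q] := by
    intro i j h
    rw [← hord, ← Units.val_mk0 hα, orderOf_units, ← pow_eq_pow_iff_modEq]
    exact Units.ext (by simpa using h)
  have lift : ∀ {t u : ℕ}, t ≡ u [MOD v] → t / v ≡ u / v [MOD q] → t ≡ u [MOD v * q] := by
    intro t u h h'
    rw [← Nat.mod_add_div t v, ← Nat.mod_add_div u v, h]
    exact (h'.mul_left' v).add_left _
  by_cases hcase : k ≠ k' ∨ ¬ p ∣ w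
  · have hmod : t ≡ u [MOD v] := by
      rw [← ZMod.natCast_eq_natCast_iff]
      refine (hc.isUnit_sub k k' w hcase).mul_left_cancel ?_
      linear_combination key t ht - key u hu
    refine lift hmod (hαpow ?_)
    have hne : (w : K) + e k' - e k ≠ 0 := by
      by_cases hk : k = k'
      · subst hk
        rw [add_sub_cancel_right, Ne, CharP.cast_eq_zero_iff K p]
        exact hcase.resolve_left (not_not_intro rfl)
      · exact he k k' hk w
    have h1 := key2 t ht
    have h2 := key2 u hu
    rw [← show t % v = u % v from hmod] at h2
    exact mul_right_cancel₀ (right_ne_zero_of_mul (h1.symm ▸ hne)) (h1.trans h2.symm)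
  · push Not at hcase
    obtain ⟨rfl, hpw⟩ := hcase
    exfalso
    refine hw.resolve_left (not_not_intro rfl) ?_
    have hck : IsUnit (c k) := by
      refine isUnit_of_mul_isUnit_left (y := 1 - a ^ 1) ?_
      have := hc.isUnit_sub k k 1 (Or.inr hp.not_dvd_one)
      rwa [mul_sub, mul_one]
    obtain ⟨w', rfl⟩ := hpw
    have hvw : v ∣ p * w' := by
      rw [← ZMod.natCast_eq_zero_iff]
      refine hck.mul_left_cancel ?_
      have := key t ht
      rw [pow_mul, hc.pow_eq_one, one_pow] at this
      linear_combination -this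
    obtain ⟨r, hr⟩ := hvw
    have hα' : α ^ 0 = α ^ r := by
      have h1 := key2 t ht
      rw [add_sub_cancel_right, (CharP.cast_eq_zero_iff K p _).2 (dvd_mul_right p w'), hr,
        Nat.add_mul_div_left _ _ hv, Nat.div_eq_of_lt (Nat.mod_lt t hv), zero_add] at h1
      rw [pow_zero]
      exact sub_eq_zero.1 ((mul_eq_zero.1 h1).resolve_left (pow_ne_zero _ hα))
    rw [mul_assoc]
    refine hpv.mul_dvd_of_dvd_of_dvd (dvd_mul_right p w') ?_
    rw [hr]
    exact mul_dvd_mul_left v ((Nat.modEq_zero_iff_dvd).1 (hαpow hα').symm)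

end hopSeq

theorem Function.Periodic.nat_modEq {β : Type*} {g : ℕ → β} {n i j : ℕ}
    (hg : Function.Periodic g n) (h : i ≡ j [MOD n]) : g i = g j := by
  rw [← hg.map_mod_nat i, ← hg.map_mod_nat j, h]

theorem card_filter_range_le_ceil {N : ℕ} (hN : 0 < N) (L : ℕ) (P : ℕ → Prop) [DecidablePred P]
    (hP : ∀ t u, P t → P u → t ≡ u [MOD N]) :
    (((Finset.range L).filter P).card : ℤ) ≤ ⌈(L : ℚ) / N⌉ := by
  rw [← Int.natCast_ceil_eq_ceil (by positivity), Nat.cast_le]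
  conv_rhs => rw [← Finset.card_range ⌈(L : ℚ) / N⌉₊]
  refine Finset.card_le_card_of_injOn (· / N) (fun t ht => ?_) fun t ht u hu h => ?_
  · simp only [Finset.coe_filter, Finset.mem_range, Set.mem_ofPred_eq] at ht
    simp only [Finset.coe_range, Set.mem_Iio, Nat.lt_ceil]
    refine Nat.cast_div_le.trans_lt ?_
    gcongr
    exact ht.1
  · simp only [Finset.coe_filter, Set.mem_ofPred_eq] at ht hu
    have h' : t / N = u / N := h
    rw [← Nat.mod_add_div t N, ← Nat.mod_add_div u N, hP t u ht.2 hu.2, h']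

theorem partialHC_le_ceil {n N : ℕ} [NeZero n] {F : Type*} [DecidableEq F] (hN : 0 < N)
    {Y Z : ℕ → F} (hY : Function.Periodic Y n) (hZ : Function.Periodic Z n) (τ j : ZMod n)
    (h : ∀ t u, Y t = Z (t + τ.val) → Y u = Z (u + τ.val) → t ≡ u [MOD N]) (L : ℕ) :
    (partialHC (fun t => Y t.val) (fun t => Z t.val) τ j L : ℤ) ≤ ⌈(L : ℚ) / N⌉ := by
  have hcast : ∀ t : ℕ, j + (t : ZMod n) = ((j.val + t : ℕ) : ZMod n) := by simp
  have hcast' : ∀ t : ℕ, j + (t : ZMod n) + τ = ((j.val + t + τ.val : ℕ) : ZMod n) := by simp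
  have hval : ∀ t : ℕ, Y (j + (t : ZMod n)).val = Y (j.val + t) := fun t => by
    rw [hcast, ZMod.val_natCast, hY.map_mod_nat]
  have hval' : ∀ t : ℕ, Z (j + (t : ZMod n) + τ).val = Z (j.val + t + τ.val) := fun t => by
    rw [hcast', ZMod.val_natCast, hZ.map_mod_nat]
  simp only [partialHC, hval, hval']
  rw [← Finset.card_filter]
  exact card_filter_range_le_ceil hN L _ fun t u ht hu =>
    Nat.ModEq.add_left_cancel' _ (h _ _ ht hu)

theorem pengFanBound_eq_s16 {p f v q : ℕ} (hp : 0 < p) (hv : 0 < v) (hf : 2 ≤ f) (hpf : p * f < q)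
    (hq : 2 * (1 + p) < q) : pengFanBound (p * v * (q - 1)) f (v * q) = p := by
  obtain ⟨r, rfl⟩ : ∃ r, q = r + 2 := ⟨q - 2, by lia⟩
  obtain ⟨A, hA⟩ : ∃ A, p * f = A + 1 :=
    Nat.exists_eq_add_one.2 (Nat.mul_pos hp (by lia))
  have hI : p * v * (r + 2 - 1) * f / (v * (r + 2)) = A := by
    rw [show p * v * (r + 2 - 1) * f = v * ((A + 1) * (r + 1)) by rw [← hA]; simp; ring,
      Nat.mul_div_mul_left _ _ hv]
    refine Nat.div_eq_of_lt_le ?_ ?_ <;> nlinarith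
  rw [pengFanBound, hI]
  have hAq : (p : ℚ) * f = A + 1 := by exact_mod_cast hA
  have hp' : (1 : ℚ) ≤ p := by exact_mod_cast hp
  have hv' : (1 : ℚ) ≤ v := by exact_mod_cast hv
  have hf' : (2 : ℚ) ≤ f := by exact_mod_cast hf
  have hr' : 2 * (p : ℚ) + 1 ≤ r := by
    have : 2 * p + 1 ≤ r := by lia
    exact_mod_cast this
  have hA0 : (0 : ℚ) ≤ A := Nat.cast_nonneg A
  have hD : 0 < (A + 1 : ℚ) * (v * (r + 1)) - 1 := by
    have : (1 : ℚ) < v * (r + 1) := by nlinarith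
    nlinarith
  have hnum : ((2 * A * (p * v * (r + 2 - 1)) * f : ℕ) : ℚ)
      - (((A + 1) * A * (v * (r + 2)) : ℕ) : ℚ) = f * (p * A * v * r) := by
    rw [show r + 2 - 1 = r + 1 by lia]
    push_cast
    linear_combination (2 * A * v * (r + 1) - A * v * r : ℚ) * hAq
  have hden : (((p * v * (r + 2 - 1) * f : ℕ) : ℚ) - 1) * f
      = f * ((A + 1) * (v * (r + 1)) - 1) := by
    rw [show r + 2 - 1 = r + 1 by lia]
    push_cast
    linear_combination (f * v * (r + 1) : ℚ) * hAq
  rw [hnum, hden, mul_div_mul_left _ _ (by positivity), Int.ceil_eq_iff, lt_div_iff₀ hD,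
    div_le_iff₀ hD]
  have hbr : 0 < (f : ℚ) * (r + 1) - p * f - r := by nlinarith
  constructor
  · push_cast
    have h1 : (p * A * v * r : ℚ) - (p - 1) * ((A + 1) * (v * (r + 1)) - 1)
        = p * v * (f * (r + 1) - p * f - r) + (p - 1) := by
      linear_combination (p * v - v * (r + 1) : ℚ) * hAq
    have h2 : 0 < (p * v : ℚ) * (f * (r + 1) - p * f - r) := by positivity
    linarith
  · push_cast
    have : (A * v * r : ℚ) ≤ (A + 1) * (v * (r + 1)) - 1 := by
      have hv0 : (0 : ℚ) ≤ v := by linarith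
      nlinarith [mul_nonneg hA0 hv0, mul_nonneg hv0 (by linarith : (0 : ℚ) ≤ r)]
    calc (p * A * v * r : ℚ) = p * (A * v * r) := by ring
      _ ≤ _ := by gcongr

theorem exists_fhs_set {p v f m : ℕ} (hp : p.Prime) (hv : 0 < v) (hm : m ≠ 0)
    (hpm : 2 < p ^ m) (hpf : p * f ≤ p ^ m) (hpv : p.Coprime v)
    (h : ∀ P : ℕ, P.Prime → P ∣ v → p ∣ P - 1 ∧ p * f ≤ P - 1) :
    ∃ X : Fin f → (ZMod (p * v * (p ^ m - 1)) → Fin (v * p ^ m)),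
      (∀ a b : Fin f, a ≠ b → X a ≠ X b) ∧
      ∀ (a b : Fin f) (τ j : ZMod (p * v * (p ^ m - 1))), a ≠ b ∨ τ ≠ 0 → ∀ L : ℕ,
        (partialHC (X a) (X b) τ j L : ℤ) ≤ ⌈(L : ℚ) / (v * (p ^ m - 1) : ℕ)⌉ := by
  have : Fact p.Prime := ⟨hp⟩
  have : NeZero v := ⟨hv.ne'⟩
  set q := p ^ m - 1
  have hq0 : 1 < q := by lia
  have : NeZero (p * v * q) := ⟨(Nat.mul_pos (Nat.mul_pos hp.pos hv) (by lia)).ne'⟩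
  let K := GaloisField p m
  have hcardK : Nat.card K = p ^ m := GaloisField.card p m hm
  obtain ⟨a, c, hac⟩ := exists_isCosetSystem (f := f) hp.pos v hv.ne' h
  obtain ⟨e, he⟩ := exists_natCast_add_sub_ne_zero (K := K) (f := f) (hcardK ▸ hpf) hp.pos
  obtain ⟨g, hg⟩ := IsCyclic.exists_generator (α := Kˣ)
  have hord : orderOf (g : K) = q := by
    rw [orderOf_units, orderOf_eq_card_of_forall_mem_zpowers hg, Nat.card_units, hcardK]
  have hcop : p.Coprime (v * q) := by
    refine Nat.Coprime.mul_right hpv ((Nat.Prime.coprime_iff_not_dvd hp).2 fun hd => ?_)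
    have h1 := (Nat.dvd_sub_iff_right (by lia : 1 ≤ p ^ m) (dvd_pow_self p hm)).1 hd
    exact hp.not_dvd_one h1
  let Y := hopSeq a c (g : K) e
  have hper : ∀ k, Function.Periodic (Y k) (p * v * q) :=
    hopSeq_periodic hv hac.pow_eq_one (hord ▸ pow_orderOf_eq_one _)
  let E : ZMod v × K ≃ Fin (v * p ^ m) := Finite.equivFinOfCardEq (by
    rw [Nat.card_prod, hcardK, Nat.card_zmod])
  have hcoin : ∀ (k k' : Fin f) (τ : ZMod (p * v * q)), k ≠ k' ∨ τ ≠ 0 → ∀ t u : ℕ,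
      E (Y k t) = E (Y k' (t + τ.val)) → E (Y k u) = E (Y k' (u + τ.val)) →
        t ≡ u [MOD v * q] := by
    intro k k' τ hτ t u ht hu
    refine hopSeq_coincidence_modEq hp hv hcop hac g.ne_zero hord he (hτ.imp_right fun hτ hd => ?_)
      (E.injective ht) (E.injective hu)
    rw [← ZMod.natCast_eq_zero_iff, ZMod.natCast_zmod_val] at hd
    exact hτ hd
  have hperE : ∀ k, Function.Periodic (fun t => E (Y k t)) (p * v * q) := fun k t =>
    congrArg E (hper k t)
  refine ⟨fun k t => E (Y k t.val), fun k k' hk hX => ?_, fun k k' τ j hτ L =>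
    partialHC_le_ceil (Nat.mul_pos hv (by lia)) (hperE k) (hperE k') τ j (hcoin k k' τ hτ) L⟩
  have hX' : ∀ t : ℕ, E (Y k t) = E (Y k' (t + (0 : ZMod (p * v * q)).val)) := fun t => by
    have := congrFun hX (t : ZMod (p * v * q))
    simp only [ZMod.val_natCast] at this
    rw [ZMod.val_zero, add_zero]
    rwa [(hper k).map_mod_nat, (hper k').map_mod_nat] at this
  have h01 := hcoin k k' 0 (Or.inl hk) 0 1 (hX' 0) (hX' 1)
  have := (Nat.modEq_iff_dvd' (Nat.zero_le 1)).1 h01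
  have hle : v * q ≤ 1 := Nat.le_of_dvd one_pos this
  nlinarith

theorem stmt16 (s : ℕ) (hs : 0 < s) (pr : Fin s → ℕ) (mE : Fin s → ℕ)
    (hpr : ∀ i, (pr i).Prime) (hmE : ∀ i, 0 < mE i) (hmono : StrictMono pr)
    (v : ℕ) (hv : v = ∏ i : Fin s, pr i ^ mE i) (hvodd : Odd v)
    (p : ℕ) (hp : p.Prime) (hdvd : ∀ i, p ∣ pr i - 1)
    (f : ℕ) (hf : f = (pr ⟨0, hs⟩ - 1) / p) (hf2 : 2 ≤ f)
    (m : ℕ) (hm : 0 < m) (hm1 : pr ⟨0, hs⟩ - 1 < p ^ m) (hm2 : 2 * (1 + p) < p ^ m) :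
    IsStrictlyOptimalFHSSet (p * v * (p ^ m - 1)) f p (v * p ^ m) := by
  have hv0 : 0 < v := hvodd.pos
  have hpf : p * f = pr ⟨0, hs⟩ - 1 := by rw [hf, Nat.mul_div_cancel' (hdvd _)]
  have hfactor : ∀ P : ℕ, P.Prime → P ∣ v → p ∣ P - 1 ∧ p * f ≤ P - 1 := by
    intro P hP hPv
    rw [hv] at hPv
    obtain ⟨i, -, hi⟩ := (hP.prime.dvd_finsetProd_iff _).1 hPv
    obtain rfl := (Nat.prime_dvd_prime_iff_eq hP (hpr i)).1 (hP.dvd_of_dvd_pow hi)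
    refine ⟨hdvd i, hpf ▸ Nat.sub_le_sub_right (hmono.monotone ?_) 1⟩
    exact Fin.mk_le_of_le_val (Nat.zero_le _)
  have hpv : p.Coprime v := (Nat.Prime.coprime_iff_not_dvd hp).2 fun hd => by
    have h1 := Nat.le_of_dvd (Nat.sub_pos_of_lt hp.one_lt) (hfactor p hp hd).1
    have := hp.pos
    lia
  obtain ⟨X, hX, hH⟩ := exists_fhs_set hp hv0 hm.ne' (by lia) (hpf ▸ hm1.le) hpv hfactor
  refine ⟨(pengFanBound_eq_s16 hp.pos hv0 hf2 (hpf ▸ hm1) hm2).symm, X, hX, fun L _ _ => ?_⟩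
  have hceil : ((L * p : ℕ) : ℚ) / (p * v * (p ^ m - 1) : ℕ)
      = (L : ℚ) / (v * (p ^ m - 1) : ℕ) := by
    rw [mul_assoc p, mul_comm L, Nat.cast_mul, Nat.cast_mul p,
      mul_div_mul_left _ _ (Nat.cast_ne_zero.2 hp.ne_zero)]
  rw [hceil]
  exact ⟨fun a τ hτ j => hH a a τ j (Or.inr hτ) L, fun a b hab τ j => hH a b τ j (Or.inl hab) L⟩
end

section
/- Let q be a prime power and let d, m be positive integers with m ≥ 4, d | q−1 and gcd(m,d) = 1. Let q′ be a prime power with q′ ≥ q and gcd(q′−1, (q−1)/d) = 1. If d ≥ 2 and q′ > q+1, then there exists a strictly optimal ((q′−1)(q^m−1)/d, d, (q−1)/d; (q^{m−1}−1+(q−1)/d)q′)-FHS set; that is, there exists a set S of M = d FHSs of length n = (q′−1)(q^m−1)/d over an alphabet of size l = (q^{m−1}−1+(q−1)/d)q′ such that H(S;L) ≤ ⌈Lλ/n⌉ for every L with 1 ≤ L ≤ n, where λ = (q−1)/d = ⌈(2InM−(I+1)Il)/((nM−1)M)⌉ with I = ⌊nM/l⌋. -/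
theorem exists_transversal_coloring {K : Type*} [Field K] [Finite K] {d e : ℕ} (he : 0 < e)
    (hK : Nat.card K = d * e + 1) :
    ∃ g : K → Fin e, ∀ x y : K, x ≠ 0 → y ≠ 0 → x ^ e = y ^ e → g x = g y → x = y := by
  classical
  obtain ⟨γ, hγ⟩ := IsCyclic.exists_generator (α := Kˣ)
  have hord : orderOf γ = d * e := by
    rw [orderOf_eq_card_of_forall_mem_zpowers hγ, Nat.card_units, hK, Nat.add_sub_cancel]
  have hlog : ∀ x : Kˣ, ∃ k < d * e, γ ^ k = x := fun x => by
    obtain ⟨k, hk⟩ := mem_powers_iff_mem_zpowers.2 (hγ x)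
    exact ⟨k % orderOf γ, hord ▸ Nat.mod_lt _ (orderOf_pos γ), (pow_mod_orderOf γ k).trans hk⟩
  choose l hl hγl using hlog
  refine ⟨fun x => if hx : x = 0 then ⟨0, he⟩ else
    ⟨l (Units.mk0 x hx) / d, Nat.div_lt_of_lt_mul (hl _)⟩, fun x y hx hy hpow hg => ?_⟩
  simp only [hx, hy, dite_false, Fin.mk.injEq] at hg
  have h1 : γ ^ (l (Units.mk0 x hx) * e) = γ ^ (l (Units.mk0 y hy) * e) := by
    rw [pow_mul, pow_mul, hγl, hγl]
    ext
    simpa using hpow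
  rw [pow_eq_pow_iff_modEq, hord] at h1
  have h2 : l (Units.mk0 x hx) = l (Units.mk0 y hy) := by
    rw [← Nat.div_add_mod (l (Units.mk0 x hx)) d, hg, Nat.ModEq.mul_right_cancel' he.ne' h1,
      Nat.div_add_mod]
  have h3 : Units.mk0 x hx = Units.mk0 y hy := by
    rw [← hγl (Units.mk0 x hx), h2, hγl]
  simpa using congrArg Units.val h3

theorem exists_leading_coefficient (K V : Type*) [Field K] [AddCommGroup V] [Module K V] :
    ∃ a : V → K, (∀ v, v ≠ 0 → a v ≠ 0) ∧ ∀ (c : K) (v : V), c ≠ 0 → a (c • v) * c = a v := by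
  classical
  choose a ha using fun (v : V) (hv : v ≠ 0) => Projectivization.exists_smul_eq_mk_rep K v hv
  refine ⟨fun v => if hv : v = 0 then 0 else a v hv, fun v hv => by simp [hv], fun c v hc => ?_⟩
  by_cases hv : v = 0
  · simp [hv]
  have hcv : c • v ≠ 0 := smul_ne_zero hc hv
  simp only [hv, hcv, dite_false]
  refine smul_left_injective K hv ?_
  have h := ha (c • v) hcv
  rw [(Projectivization.mk_eq_mk_iff' K (c • v) v hcv hv).2 ⟨c, rfl⟩, ← ha v hv,
    Units.smul_def, Units.smul_def, smul_smul] at h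
  exact h

/-- The nonzero elements of `F` are coloured so that points of the same colour lie on a common
translate of the line `K` and are distinguished by an index invariant under multiplication by
the `e`-th roots of unity of `K`. -/
theorem exists_colored_index {K F : Type*} [Field K] [Finite K] [Field F] [Finite F] [Algebra K F]
    {d e m : ℕ} (he : 0 < e) (hK : Nat.card K = d * e + 1)
    (hF : Nat.card F = Nat.card K ^ (m + 1)) :
    ∃ (s : F → Fin (Nat.card K ^ m - 1 + e)) (i : F → K),
      (∀ (ω : K) (x : F), ω ≠ 0 → ω ^ e = 1 → i (algebraMap K F ω * x) = i x) ∧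
      (∀ x y : F, x ≠ 0 → y ≠ 0 → s x = s y → ∃ c : K, x - y = algebraMap K F c) ∧
      (∀ x y : F, x ≠ 0 → y ≠ 0 → s x = s y → i x = i y → x = y) := by
  classical
  obtain ⟨p, hp⟩ := (Algebra.linearMap K F).exists_leftInverse_of_injective
    (LinearMap.ker_eq_bot.2 (algebraMap K F).injective)
  have hp1 (c : K) : p (algebraMap K F c) = c := LinearMap.congr_fun hp c
  have hps : Function.Surjective p := fun c => ⟨_, hp1 c⟩
  obtain ⟨g, hg⟩ := exists_transversal_coloring he hK
  obtain ⟨a, ha0, ha⟩ := exists_leading_coefficient K (LinearMap.ker p)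
  have hcard : Nat.card (LinearMap.ker p) = Nat.card K ^ m := by
    have h := Submodule.card_eq_card_quotient_mul_card (LinearMap.ker p)
    rw [Nat.card_congr (p.quotKerEquivOfSurjective hps).toEquiv, hF, pow_succ] at h
    exact (Nat.eq_of_mul_eq_mul_right Nat.card_pos h).symm
  let B := {v : LinearMap.ker p // v ≠ 0} ⊕ Fin e
  have hB : Nat.card B = Nat.card K ^ m - 1 + e := by
    rw [Nat.card_sum, Nat.card_fin, ← hcard]
    congr 1
    have := Fintype.ofFinite (LinearMap.ker p)
    rw [Nat.card_eq_fintype_card, Nat.card_eq_fintype_card, Fintype.card_subtype_compl]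
    simp
  let ε : B ≃ Fin (Nat.card K ^ m - 1 + e) := Finite.equivFinOfCardEq hB
  let π (x : F) : LinearMap.ker p :=
    ⟨x - algebraMap K F (p x), by rw [LinearMap.mem_ker, map_sub, hp1, sub_self]⟩
  have hπx (x : F) : x = algebraMap K F (p x) + π x := by simp [π]
  have hmul (c : K) (x : F) : algebraMap K F c * x = c • x := (Algebra.smul_def c x).symm
  have hπs (c : K) (x : F) : π (c • x) = c • π x := by
    ext
    simp only [π, map_smul, smul_eq_mul, map_mul, Submodule.coe_smul, smul_sub,
      ← hmul c (algebraMap K F _)]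
  let σ (x : F) : B := if h : π x = 0 then Sum.inr (g (p x)) else Sum.inl ⟨π x, h⟩
  let i (x : F) : K := if π x = 0 then p x ^ e else p x * a (π x)
  have hσ (x y : F) (h : σ x = σ y) : π x = π y := by
    by_cases hx : π x = 0 <;> by_cases hy : π y = 0 <;> simp [σ, hx, hy] at h ⊢
    exact congrArg Subtype.val (Sum.inl_injective h)
  refine ⟨ε ∘ σ, i, fun ω x hω0 hω => ?_, fun x y _ _ h => ?_, fun x y hx hy h hi => ?_⟩
  · rw [hmul]
    simp only [i, hπs, smul_eq_zero, hω0, false_or, map_smul, smul_eq_mul, mul_pow, hω, one_mul]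
    split_ifs
    · rfl
    · rw [← ha ω (π x) hω0]
      ring
  · have h1 := hσ x y (ε.injective h)
    refine ⟨p x - p y, ?_⟩
    rw [map_sub, sub_eq_sub_iff_sub_eq_sub]
    exact congrArg Subtype.val h1
  · have h2 : σ x = σ y := ε.injective h
    have h1 := hσ x y h2
    suffices p x = p y by rw [hπx x, hπx y, h1, this]
    by_cases hz : π y = 0
    · have hz' := h1.trans hz
      simp only [i, σ, hz, hz', dite_true, if_true] at hi h2
      refine hg _ _ (fun h0 => hx ?_) (fun h0 => hy ?_) hi (Sum.inr_injective h2)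
      · rw [hπx x, h0, hz']; simp
      · rw [hπx y, h0, hz]; simp
    · simp only [i, h1, hz, if_false] at hi
      exact mul_right_cancel₀ (ha0 _ hz) hi

/-- The hopping sequence whose term at time `t` is the colour of `α ^ (a + d * t)` together with
the index of that point, translated by `θ ^ ⌊t / N⌋`. -/
def coloredSeq {A K F R : Type*} [Field F] [Field R] (s : F → A) (i : F → K) (ι : K → R)
    (α : Fˣ) (θ : Rˣ) (d N a t : ℕ) : A × R :=
  (s (α ^ (a + d * t) : Fˣ), (θ ^ (t / N) : Rˣ) + ι (i (α ^ (a + d * t) : Fˣ)))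

theorem coloredSeq_mod {A K F R : Type*} [Field F] [Field R] (s : F → A) (i : F → K) (ι : K → R)
    {α : Fˣ} {θ : Rˣ} {d e N : ℕ} (hα : orderOf α = d * e * N) (a t : ℕ) :
    coloredSeq s i ι α θ d N a (t % (N * (e * orderOf θ))) = coloredSeq s i ι α θ d N a t := by
  have h1 : α ^ (a + d * (t % (N * (e * orderOf θ)))) = α ^ (a + d * t) := by
    rw [pow_eq_pow_iff_modEq, hα]
    refine Nat.ModEq.add_left a ?_
    rw [show d * e * N = d * (N * e) by ring]
    exact Nat.ModEq.mul_left' d ((Nat.mod_modEq _ _).of_dvd ⟨orderOf θ, by ring⟩)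
  have h2 : θ ^ (t % (N * (e * orderOf θ)) / N) = θ ^ (t / N) := by
    rw [Nat.mod_mul_right_div_self, pow_eq_pow_iff_modEq]
    exact (Nat.mod_modEq _ _).of_dvd ⟨e, by ring⟩
  simp only [coloredSeq, h1, h2]

theorem modEq_of_coloredSeq_eq {A K F R : Type*} [Field K] [Field F] [Field R] [Algebra K F]
    {s : F → A} {i : F → K} {ι : K → R} {α : Fˣ} {θ : Rˣ} {d e N : ℕ}
    (hi : ∀ (ω : K) (x : F), ω ≠ 0 → ω ^ e = 1 → i (algebraMap K F ω * x) = i x)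
    (hs : ∀ x y : F, x ≠ 0 → y ≠ 0 → s x = s y → ∃ c : K, x - y = algebraMap K F c)
    (hsi : ∀ x y : F, x ≠ 0 → y ≠ 0 → s x = s y → i x = i y → x = y)
    (hι : Function.Injective ι) (hα : orderOf α = d * e * N)
    (hK : ∀ c : K, c ≠ 0 → c ^ (d * e) = 1) (hd : 0 < d) (he : 0 < e) (hN : 0 < N)
    (hNd : N.Coprime d) (hθ : (orderOf θ).Coprime e) {a b τ : ℕ} (ha : a < d) (hb : b < d)
    (hab : ¬(a = b ∧ N * e * orderOf θ ∣ τ)) {u v : ℕ}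
    (hu : coloredSeq s i ι α θ d N a u = coloredSeq s i ι α θ d N b (u + τ))
    (hv : coloredSeq s i ι α θ d N a v = coloredSeq s i ι α θ d N b (v + τ)) :
    u ≡ v [MOD N * orderOf θ] := by
  obtain ⟨hu1, hu2⟩ := Prod.ext_iff.1 hu
  obtain ⟨hv1, hv2⟩ := Prod.ext_iff.1 hv
  simp only [coloredSeq] at hu1 hu2 hv1 hv2
  set y : Fˣ := α ^ (b + d * τ) * (α ^ a)⁻¹ with hy
  have hshift (t : ℕ) : α ^ (b + d * (t + τ)) = α ^ (a + d * t) * y := by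
    rw [hy, ← mul_assoc, eq_mul_inv_iff_mul_eq]
    simp only [← pow_add]
    congr 1
    ring
  have hfloor (t : ℕ) : (t + τ) / N = t / N + (t % N + τ) / N := by
    conv_lhs => rw [← Nat.div_add_mod t N, add_assoc, Nat.mul_add_div hN]
  rw [hshift] at hu1 hu2 hv1 hv2
  by_cases hy1 : y = 1
  · exfalso
    rw [hy, mul_inv_eq_one, pow_eq_pow_iff_modEq, hα] at hy1
    have hba : b = a := by
      have h : b + d * τ ≡ a [MOD d] := hy1.of_dvd ⟨e * N, by ring⟩
      have h' : b ≡ a [MOD d] := by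
        simpa [Nat.ModEq, Nat.add_mul_mod_self_left] using h
      exact h'.eq_of_lt_of_lt hb ha
    subst hba
    have hτ : N * e ∣ τ := by
      have h : d * τ ≡ d * 0 [MOD d * (N * e)] := by
        have := Nat.ModEq.add_left_cancel' b (show b + d * τ ≡ b + 0 [MOD d * e * N] from hy1)
        rwa [show d * e * N = d * (N * e) by ring] at this
      exact (Nat.modEq_zero_iff_dvd).1 (Nat.ModEq.mul_left_cancel' hd.ne' h)
    obtain ⟨j, rfl⟩ := hτ
    rw [show y = 1 by rw [hy, mul_inv_eq_one, pow_eq_pow_iff_modEq, hα]; exact hy1, mul_one,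
      add_left_inj, Units.val_inj, mul_assoc, Nat.add_mul_div_left _ _ hN, pow_add,
      left_eq_mul] at hu2
    have hj := hθ.dvd_of_dvd_mul_left (orderOf_dvd_of_pow_eq_one hu2)
    exact hab ⟨rfl, Nat.mul_dvd_mul_left _ hj⟩
  have hline (t : ℕ) (ht : s (α ^ (a + d * t) : Fˣ) = s (α ^ (a + d * t) * y : Fˣ)) :
      ∃ c : K, c ≠ 0 ∧ (α ^ (a + d * t) : Fˣ) * (1 - (y : F)) = algebraMap K F c := by
    obtain ⟨c, hc⟩ := hs _ _ (Units.ne_zero _) (Units.ne_zero _) ht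
    rw [Units.val_mul, ← mul_one_sub] at hc
    refine ⟨c, fun h0 => ?_, hc⟩
    rw [h0, map_zero] at hc
    rcases mul_eq_zero.1 hc with h | h
    · exact Units.ne_zero _ h
    · exact hy1 (Units.ext (sub_eq_zero.1 h).symm)
  obtain ⟨c, hc0, hc⟩ := hline u hu1
  obtain ⟨c', hc0', hc'⟩ := hline v hv1
  have hy0 : (1 - (y : F)) ≠ 0 := fun h => hy1 (Units.ext (sub_eq_zero.1 h).symm)
  have hω0 : c' / c ≠ 0 := div_ne_zero hc0' hc0
  have hω : ((α ^ (a + d * v) : Fˣ) : F) = algebraMap K F (c' / c) * (α ^ (a + d * u) : Fˣ) := by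
    refine mul_right_cancel₀ hy0 ?_
    rw [mul_assoc, hc, hc', ← map_mul, div_mul_cancel₀ _ hc0]
  have huv : u ≡ v [MOD N] := by
    have h := congrArg (· ^ (d * e)) hω
    simp only [mul_pow, ← map_pow, hK _ hω0, map_one, one_mul, ← Units.val_pow_eq_pow_val,
      Units.val_inj] at h
    rw [← pow_mul, ← pow_mul, pow_eq_pow_iff_modEq, hα, mul_comm _ (d * e),
      mul_comm _ (d * e)] at h
    have h' := Nat.ModEq.add_left_cancel' a (Nat.ModEq.mul_left_cancel' (by positivity) h)
    exact (Nat.ModEq.cancel_left_of_coprime hNd h').symm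
  have hωe : (c' / c) ^ e = 1 := by
    have h : α ^ ((a + d * v) * e) = α ^ ((a + d * u) * e) := by
      rw [pow_eq_pow_iff_modEq, hα, show d * e * N = d * N * e by ring]
      exact ((huv.symm.mul_left' d).add_left a).mul_right' e
    have h' := congrArg (· ^ e) hω
    simp only [mul_pow, ← map_pow, ← Units.val_pow_eq_pow_val, ← pow_mul, h] at h'
    refine (algebraMap K F).injective ?_
    rw [map_one]
    exact (right_eq_mul₀ (Units.ne_zero _)).1 h'
  have hi1 : i (α ^ (a + d * v) : Fˣ) = i (α ^ (a + d * u) : Fˣ) := by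
    rw [hω, hi _ _ hω0 hωe]
  have hi2 : i (α ^ (a + d * v) * y : Fˣ) = i (α ^ (a + d * u) * y : Fˣ) := by
    rw [Units.val_mul _ y, hω, mul_assoc, hi _ _ hω0 hωe, Units.val_mul _ y]
  have hne : ι (i (α ^ (a + d * u) : Fˣ)) ≠ ι (i (α ^ (a + d * u) * y : Fˣ)) := fun h =>
    hy1 (left_eq_mul.1 (Units.ext (hsi _ _ (Units.ne_zero _) (Units.ne_zero _) hu1 (hι h))))
  rw [hi1, hi2, hfloor, ← huv, pow_add θ, Units.val_mul] at hv2
  rw [hfloor, pow_add θ, Units.val_mul] at hu2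
  have hk : u / N ≡ v / N [MOD orderOf θ] := by
    rw [← pow_eq_pow_iff_modEq, ← Units.val_inj]
    refine mul_right_cancel₀ (b := 1 - ((θ ^ ((u % N + τ) / N) : Rˣ) : R)) (fun h => hne ?_) ?_
    · rw [← sub_eq_zero.1 h, mul_one] at hu2
      exact add_left_cancel hu2
    · linear_combination hu2 - hv2
  have hmod : u % N = v % N := huv
  rw [← Nat.div_add_mod u N, ← Nat.div_add_mod v N, hmod]
  exact (hk.mul_left' N).add_right _

theorem card_filter_le_ceil_div {L W : ℕ} (hW : 0 < W) (P : ℕ → Prop) [DecidablePred P]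
    (hP : ∀ t t', P t → P t' → t ≡ t' [MOD W]) :
    ((Finset.range L).filter P).card ≤ ⌈(L : ℚ) / W⌉₊ := by
  rw [← Finset.card_range ⌈(L : ℚ) / W⌉₊]
  refine Finset.card_le_card_of_injOn (· / W) (fun t ht => ?_) (fun t ht t' ht' h => ?_)
  · have htL : t < L := Finset.mem_range.1 (Finset.mem_filter.1 ht).1
    have hW' : (0 : ℚ) < W := by exact_mod_cast hW
    simp only [Finset.coe_range, Set.mem_Iio]
    rw [Nat.lt_ceil, lt_div_iff₀ hW']
    exact_mod_cast (Nat.div_mul_le_self t W).trans_lt htL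
  · have hm : t % W = t' % W := hP t t' (Finset.mem_filter.1 ht).2 (Finset.mem_filter.1 ht').2
    rw [← Nat.div_add_mod t W, ← Nat.div_add_mod t' W, hm, show t / W = t' / W from h]

theorem pengFan_estimates {q q' d e A : ℤ} (hd : 2 ≤ d) (he : 1 ≤ e) (hq : q - 1 = d * e)
    (hq' : q + 2 ≤ q') (hA : q ^ 3 ≤ A + 1) :
    (q - 1) * ((A + e) * q') ≤ (q' - 1) * (q * A + (q - 1)) ∧
    (q' - 1) * (q * A + (q - 1)) < q * ((A + e) * q') ∧
    0 < (q' - 1) * (q * A + (q - 1)) -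
      e * (q * ((A + e) * q') - (q' - 1) * (q * A + (q - 1))) + e - 1 := by
  have h2 : 2 * e ≤ q - 1 := by rw [hq]; nlinarith
  have hA' : (q - 1) * (q ^ 2 + q + 1) ≤ A := by nlinarith
  obtain ⟨s, rfl⟩ : ∃ s, q' = q + 2 + s := ⟨q' - q - 2, by ring⟩
  obtain ⟨r, rfl⟩ : ∃ r, q = 2 * e + 1 + r := ⟨q - 2 * e - 1, by ring⟩
  obtain ⟨b, rfl⟩ : ∃ b, A = (2 * e + 1 + r - 1) *
      ((2 * e + 1 + r) ^ 2 + (2 * e + 1 + r) + 1) + b :=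
    ⟨A - (2 * e + 1 + r - 1) * ((2 * e + 1 + r) ^ 2 + (2 * e + 1 + r) + 1), by ring⟩
  obtain ⟨f, rfl⟩ : ∃ f, e = 1 + f := ⟨e - 1, by ring⟩
  have hs : 0 ≤ s := by linarith
  have hr : 0 ≤ r := by linarith
  have hb : 0 ≤ b := by linarith
  have hf : 0 ≤ f := by linarith
  refine ⟨?_, ?_, ?_⟩
  · rw [← sub_nonneg]
    ring_nf
    positivity
  · rw [← sub_pos]
    ring_nf
    positivity
  · ring_nf
    positivity

theorem exists_periodic_family {q q' d e r m : ℕ} (hq : IsPrimePow q) (hq' : IsPrimePow q')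
    (hde : q = d * e + 1) (hr : q' = r + 1) (hd : 0 < d) (he : 0 < e) (hqq' : q ≤ q')
    (hre : r.Coprime e) (hmd : (m + 1).Coprime d) :
    ∃ S : ℕ → ℕ → Fin ((q ^ m - 1 + e) * q'),
      (∀ a t, S a (t % ((∑ k ∈ Finset.range (m + 1), q ^ k) * (e * r))) = S a t) ∧
      ∀ a b τ u v, a < d → b < d →
        ¬(a = b ∧ (∑ k ∈ Finset.range (m + 1), q ^ k) * (e * r) ∣ τ) →
        S a u = S b (u + τ) → S a v = S b (v + τ) →
        u ≡ v [MOD (∑ k ∈ Finset.range (m + 1), q ^ k) * r] := by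
  obtain ⟨p, k, hp, hk, rfl⟩ := (isPrimePow_nat_iff q).1 hq
  obtain ⟨p', k', hp', hk', rfl⟩ := (isPrimePow_nat_iff q').1 hq'
  have : Fact p.Prime := ⟨hp⟩
  have : Fact p'.Prime := ⟨hp'⟩
  let K := GaloisField p k
  let F := FiniteField.Extension K p (m + 1)
  let R := GaloisField p' k'
  have hK : Nat.card K = p ^ k := GaloisField.card p k hk.ne'
  have hF : Nat.card F = Nat.card K ^ (m + 1) := FiniteField.natCard_extension K p (m + 1)
  have hR : Nat.card R = p' ^ k' := GaloisField.card p' k' hk'.ne'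
  obtain ⟨s, i, hi, hs, hsi⟩ := exists_colored_index (F := F) he (hK.trans hde) hF
  obtain ⟨α, hα⟩ := IsCyclic.exists_generator (α := Fˣ)
  obtain ⟨θ, hθ⟩ := IsCyclic.exists_generator (α := Rˣ)
  set N := ∑ j ∈ Finset.range (m + 1), (p ^ k) ^ j with hN
  have hNα : orderOf α = d * e * N := by
    rw [orderOf_eq_card_of_forall_mem_zpowers hα, Nat.card_units, hF, hK, hN, hde,
      ← geom_sum_mul_add (d * e) (m + 1), Nat.add_sub_cancel, mul_comm]
  have hrθ : orderOf θ = r := by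
    rw [orderOf_eq_card_of_forall_mem_zpowers hθ, Nat.card_units, hR, hr, Nat.add_sub_cancel]
  have hN0 : 0 < N := by
    rw [hN, Finset.sum_range_succ']
    exact Nat.add_pos_right _ (by simp)
  have hNd : N.Coprime d := by
    have h : N ≡ m + 1 [MOD d] := by
      have : N ≡ ∑ j ∈ Finset.range (m + 1), 1 ^ j [MOD d] := by
        refine Nat.ModEq.sum fun j _ => Nat.ModEq.pow j ?_
        rw [hde]
        simp [Nat.ModEq]
      simpa using this
    exact h.gcd_eq.trans hmd
  have hKpow (c : K) (hc : c ≠ 0) : c ^ (d * e) = 1 := by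
    have h := pow_card_eq_one' (x := Units.mk0 c hc)
    rw [Nat.card_units, hK, hde, Nat.add_sub_cancel] at h
    simpa using congrArg Units.val h
  obtain ⟨ι⟩ : Nonempty (K ↪ R) := by
    have := Fintype.ofFinite K
    have := Fintype.ofFinite R
    refine Function.Embedding.nonempty_of_card_le ?_
    rwa [Fintype.card_eq_nat_card, Fintype.card_eq_nat_card, hK, hR]
  let ε : Fin (Nat.card K ^ m - 1 + e) × R ≃ Fin (((p ^ k) ^ m - 1 + e) * p' ^ k') :=
    Finite.equivFinOfCardEq (by rw [Nat.card_prod, Nat.card_fin, hK, hR])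
  refine ⟨fun a t => ε (coloredSeq s i ι α θ d N a t), fun a t => ?_,
    fun a b τ u v ha hb hab hu hv => ?_⟩
  · beta_reduce
    rw [← hrθ, coloredSeq_mod s i ι hNα]
  · rw [← hrθ] at hab hre ⊢
    rw [← mul_assoc] at hab
    exact modEq_of_coloredSeq_eq hi hs hsi ι.injective hNα hKpow hd he hN0 hNd hre ha hb hab
      (ε.injective hu) (ε.injective hv)

theorem partialHC_comp_val_le {F : Type*} [DecidableEq F] {n W : ℕ} [NeZero n] (hW : 0 < W)
    {x y : ℕ → F} (hx : ∀ t, x (t % n) = x t) (hy : ∀ t, y (t % n) = y t) (τ j : ZMod n)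
    (h : ∀ u v, x u = y (u + τ.val) → x v = y (v + τ.val) → u ≡ v [MOD W]) (L : ℕ) :
    (partialHC (fun t : ZMod n => x t.val) (fun t => y t.val) τ j L : ℤ) ≤ ⌈(L : ℚ) / W⌉ := by
  have hxv (t : ℕ) : x (j + (t : ZMod n)).val = x (j.val + t) := by
    rw [← hx (j.val + t), ← ZMod.val_natCast]
    simp
  have hyv (t : ℕ) : y (j + (t : ZMod n) + τ).val = y (j.val + t + τ.val) := by
    rw [← hy (j.val + t + τ.val), ← ZMod.val_natCast]
    simp
  rw [← Int.natCast_ceil_eq_ceil (by positivity)]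
  simp only [partialHC, hxv, hyv, Finset.sum_boole, Nat.cast_id]
  exact_mod_cast card_filter_le_ceil_div hW _ fun t t' ht ht' =>
    Nat.ModEq.add_left_cancel' j.val (h _ _ ht ht')

theorem pengFanBound_eq_s18 {n d e l : ℕ} (hd : 0 < d) (hn : 1 < n * d) (h₁ : d * e * l ≤ n * d)
    (h₂ : n * d < (d * e + 1) * l)
    (h₃ : (0 : ℤ) < n * d - e * ((d * e + 1) * l - n * d) + e - 1) :
    pengFanBound n d l = e := by
  have hI : n * d / l = d * e := Nat.div_eq_of_lt_le h₁ h₂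
  have hd' : (0 : ℚ) < d := by exact_mod_cast hd
  have hn' : (1 : ℚ) < n * d := by exact_mod_cast hn
  have h₂' : (n * d + 1 : ℚ) ≤ (d * e + 1) * l := by exact_mod_cast h₂
  have h₃' : (0 : ℚ) < n * d - e * ((d * e + 1) * l - n * d) + e - 1 := by exact_mod_cast h₃
  rw [pengFanBound, hI, Int.ceil_eq_iff]
  push_cast
  have hden : (0 : ℚ) < (n * d - 1) * d := mul_pos (by linarith) hd'
  rw [lt_div_iff₀ hden, div_le_iff₀ hden]
  constructor
  · have := mul_pos hd' h₃'
    linarith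
  · have := mul_le_mul_of_nonneg_left h₂' (show (0 : ℚ) ≤ d * e by positivity)
    linarith

theorem stmt18 (q q' d m : ℕ) (hq : IsPrimePow q) (hq' : IsPrimePow q')
    (hd : 0 < d) (hm : 4 ≤ m) (hdq : d ∣ q - 1) (hgcd : Nat.gcd m d = 1)
    (hqq' : q ≤ q') (hgcd' : Nat.gcd (q' - 1) ((q - 1) / d) = 1)
    (hd2 : 2 ≤ d) (hq'q : q + 1 < q') :
    IsStrictlyOptimalFHSSet ((q' - 1) * (q ^ m - 1) / d) d ((q - 1) / d)
      ((q ^ (m - 1) - 1 + (q - 1) / d) * q') := by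
  obtain ⟨e, he⟩ := hdq
  have hq1 := hq.one_lt
  have hde : q = d * e + 1 := by omega
  have he0 : 0 < e := Nat.pos_of_ne_zero fun h => by simp [h] at hde; omega
  obtain ⟨r, hr⟩ : ∃ r, q' = r + 1 := ⟨q' - 1, by omega⟩
  obtain ⟨m, rfl⟩ : ∃ m', m = m' + 1 := ⟨m - 1, by omega⟩
  have hdiv : (q - 1) / d = e := by rw [he, Nat.mul_div_cancel_left _ hd]
  have hr' : q' - 1 = r := by omega
  rw [hdiv, hr'] at hgcd'
  rw [hdiv, hr', Nat.add_sub_cancel]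
  obtain ⟨S, hSper, hS⟩ := exists_periodic_family hq hq' hde hr hd he0 hqq' hgcd' hgcd
  set N := ∑ k ∈ Finset.range (m + 1), q ^ k with hN
  have hgeom : q ^ (m + 1) = N * (d * e) + 1 := by
    rw [hN, hde, geom_sum_mul_add]
  have hn : r * (q ^ (m + 1) - 1) / d = N * (e * r) := by
    rw [hgeom, Nat.add_sub_cancel, show r * (N * (d * e)) = d * (N * (e * r)) by ring,
      Nat.mul_div_cancel_left _ hd]
  have hN1 : 1 < N := by
    have h : q ^ 1 < q ^ (m + 1) := Nat.pow_lt_pow_right hq1 (by omega)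
    rw [hgeom, pow_one, hde, Nat.add_lt_add_iff_right] at h
    exact Nat.lt_of_mul_lt_mul_right ((one_mul _).trans_lt h)
  have hr0 : 0 < r := by omega
  have hW : 1 < N * r := Nat.one_lt_mul_iff.2 ⟨by omega, hr0, Or.inl hN1⟩
  rw [hn]
  have : NeZero (N * (e * r)) := ⟨by positivity⟩
  have hceil (L : ℕ) : ((L * e : ℕ) : ℚ) / (N * (e * r) : ℕ) = L / (N * r : ℕ) := by
    have : (e : ℚ) ≠ 0 := by exact_mod_cast he0.ne'
    push_cast
    rw [show (N * (e * r) : ℚ) = N * r * e by ring, mul_div_mul_right _ _ this]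
  obtain ⟨A, hA⟩ : ∃ A, q ^ m = A + 1 :=
    ⟨q ^ m - 1, by have := Nat.pow_pos (n := m) hq.pos; omega⟩
  have hT : (N * (e * r) * d : ℤ) = (q' - 1) * (q * A + (q - 1)) := by
    rw [pow_succ, hA] at hgeom
    have hgeom' : ((A + 1) * q : ℤ) = N * (d * e) + 1 := by exact_mod_cast hgeom
    rw [hr]
    push_cast
    linear_combination -r * hgeom'
  have hdeZ : (q : ℤ) - 1 = d * e := by rw [hde]; push_cast; ring
  have hqde : (q : ℤ) = d * e + 1 := by linear_combination hdeZ
  have hA3 : (q : ℤ) ^ 3 ≤ A + 1 := by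
    exact_mod_cast hA ▸ Nat.pow_le_pow_right hq.pos (by omega : 3 ≤ m)
  obtain ⟨h₁, h₂, h₃⟩ := pengFan_estimates (d := d) (e := e) (q := q) (q' := q') (A := A)
    (by exact_mod_cast hd2) (by exact_mod_cast he0) hdeZ (by exact_mod_cast hq'q) hA3
  rw [← hT] at h₁ h₂ h₃
  have hbound : pengFanBound (N * (e * r)) d ((q ^ m - 1 + e) * q') = e := by
    rw [hA, Nat.add_sub_cancel]
    refine pengFanBound_eq_s18 hd ?_ ?_ ?_ ?_
    · have : d ≤ N * (e * r) * d := Nat.le_mul_of_pos_left d (by positivity)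
      omega
    · rw [hdeZ] at h₁
      exact_mod_cast h₁
    · rw [← hde]
      exact_mod_cast h₂
    · rw [← hqde]
      push_cast
      exact h₃
  refine ⟨hbound.symm, fun a t => S a t.val, fun a b hab h => ?_,
    fun L _ _ => ⟨fun a τ hτ j => ?_, fun a b hab τ j => ?_⟩⟩
  · have hSab (t : ℕ) : S a t = S b (t + 0) := by
      rw [Nat.add_zero, ← hSper a t, ← hSper b t, ← ZMod.val_natCast]
      exact congrFun h (t : ZMod (N * (e * r)))
    have h01 := hS a b 0 0 1 a.2 b.2 (fun h => hab (Fin.ext h.1)) (hSab 0) (hSab 1)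
    simp [Nat.ModEq, Nat.mod_eq_of_lt hW] at h01
  · rw [hceil]
    refine partialHC_comp_val_le (by omega) (hSper a) (hSper a) τ j (fun u v => ?_) L
    refine hS a a τ.val u v a.2 a.2 fun h => hτ ?_
    rw [← ZMod.natCast_zmod_val τ]
    exact (ZMod.natCast_eq_zero_iff _ _).2 h.2
  · rw [hceil]
    refine partialHC_comp_val_le (by omega) (hSper a) (hSper b) τ j (fun u v => ?_) L
    exact hS a b τ.val u v a.2 b.2 fun h => hab (Fin.ext h.1)
end
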